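/- arXiv:2111.01062 — 2 statements merged into one kernel-verified Lean document; each statement's English description precedes it below -/
import Mathlib

section
/- Let d≥3 and let V and Y be real Γ-periodic potentials on ℤ^d. If F_{λ_0}(V)=F_{λ_0}(Y) for some λ_0∈ℂ, then 𝒫_V(z,λ_0)=𝒫_Y(z,λ_0) for all z∈(ℂ\{0})^d. -/
noncomputable section

/-- The discrete Laplacian on `ℤ^d`: `(Δu)(n) = Σ_{‖n'-n‖₁ = 1} u(n')`. -/
def discLap {d : ℕ} (u : (Fin d → ℤ) → ℂ) (n : Fin d → ℤ) : ℂ :=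
  ∑ j : Fin d, (u (Function.update n j (n j + 1)) + u (Function.update n j (n j - 1)))

/-- Reduction of an integer modulo `q`, as an element of `Fin q`. -/
def fem (q : ℕ+) (a : ℤ) : Fin (q : ℕ) :=
  ⟨(a % ((q : ℕ) : ℤ)).toNat, by
    have hq : (0:ℤ) < ((q : ℕ) : ℤ) := by exact_mod_cast q.pos
    have h1 : 0 ≤ a % ((q : ℕ) : ℤ) := Int.emod_nonneg a (ne_of_gt hq)
    have h2 : a % ((q : ℕ) : ℤ) < ((q : ℕ) : ℤ) := Int.emod_lt_of_pos a hq
    omega⟩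

/-- Extension of a function on the fundamental domain `W` to `ℤ^d` using the
Floquet boundary conditions `u(n + qⱼ eⱼ) = zⱼ u(n)`. -/
def extendBC {d : ℕ} (q : Fin d → ℕ+) (z : Fin d → ℂ)
    (u : (∀ j, Fin ((q j : ℕ))) → ℂ) : (Fin d → ℤ) → ℂ :=
  fun n => (∏ j, z j ^ (n j / ((q j : ℕ) : ℤ))) * u (fun j => fem (q j) (n j))

/-- The matrix `D_V(z)` of the Floquet reduction of `-Δ + V` to the fundamental domain. -/
def DVmat {d : ℕ} (q : Fin d → ℕ+) (V : (Fin d → ℤ) → ℂ) (z : Fin d → ℂ) :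
    Matrix (∀ j, Fin ((q j : ℕ))) (∀ j, Fin ((q j : ℕ))) ℂ :=
  fun n n' =>
    -(discLap (extendBC q z (Pi.single n' 1)) (fun j => ((n j : ℕ) : ℤ)))
      + V (fun j => ((n j : ℕ) : ℤ)) * (if n = n' then 1 else 0)

/-- `𝒫_V(z, λ) = det(D_V(z) - λ I)`. -/
def scriptP {d : ℕ} (q : Fin d → ℕ+) (V : (Fin d → ℤ) → ℂ) (z : Fin d → ℂ)
    (lam : ℂ) : ℂ :=
  Matrix.det (DVmat q V z - lam • (1 : Matrix (∀ j, Fin ((q j : ℕ))) (∀ j, Fin ((q j : ℕ))) ℂ))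

/-- `Γ`-periodicity for a complex-valued function on `ℤ^d`. -/
def IsPeriodic {d : ℕ} (q : Fin d → ℕ+) (V : (Fin d → ℤ) → ℂ) : Prop :=
  ∀ (n : Fin d → ℤ) (j : Fin d), V (Function.update n j (n j + ((q j : ℕ) : ℤ))) = V n

/-- `Γ`-periodicity for a real-valued function on `ℤ^d`. -/
def IsPeriodicR {d : ℕ} (q : Fin d → ℕ+) (V : (Fin d → ℤ) → ℝ) : Prop :=
  ∀ (n : Fin d → ℤ) (j : Fin d), V (Function.update n j (n j + ((q j : ℕ) : ℤ))) = V n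

/-- `ρ_m = e^{2πi m / q}`. -/
def rho (q : ℕ+) (m : ℕ) : ℂ :=
  Complex.exp (2 * (Real.pi : ℂ) * Complex.I * (m : ℂ) / ((q : ℕ) : ℂ))

/-- The discrete Fourier transform `V̂(l)` of a periodic potential. -/
def dft {d : ℕ} (q : Fin d → ℕ+) (V : (Fin d → ℤ) → ℂ) (l : Fin d → ℤ) : ℂ :=
  (1 / ((∏ j, (q j : ℕ) : ℕ) : ℂ)) * ∑ n : (∀ j, Fin ((q j : ℕ))),
    V (fun j => ((n j : ℕ) : ℤ)) *
      Complex.exp (-(2 * (Real.pi : ℂ) * Complex.I) * ∑ j, (l j : ℂ) * ((n j : ℕ) : ℂ) / ((q j : ℕ) : ℂ))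

/-- The diagonal matrix `A(z)` with entries `-Σⱼ (ρʲ_{nⱼ} zⱼ + 1/(ρʲ_{nⱼ} zⱼ))`. -/
def Amat {d : ℕ} (q : Fin d → ℕ+) (z : Fin d → ℂ) :
    Matrix (∀ j, Fin ((q j : ℕ))) (∀ j, Fin ((q j : ℕ))) ℂ :=
  Matrix.diagonal fun n => -(∑ j, (rho (q j) (n j) * z j + (rho (q j) (n j) * z j)⁻¹))

/-- The matrix `B_V` with entries `V̂(n - n')`. -/
def Bmat {d : ℕ} (q : Fin d → ℕ+) (V : (Fin d → ℤ) → ℂ) :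
    Matrix (∀ j, Fin ((q j : ℕ))) (∀ j, Fin ((q j : ℕ))) ℂ :=
  fun n n' => dft q V (fun j => ((n j : ℕ) : ℤ) - ((n' j : ℕ) : ℤ))

/-- The average `[V]` of a periodic potential. -/
def avgPot {d : ℕ} (q : Fin d → ℕ+) (V : (Fin d → ℤ) → ℂ) : ℂ :=
  (1 / ((∏ j, (q j : ℕ) : ℕ) : ℂ)) * ∑ n : (∀ j, Fin ((q j : ℕ))), V (fun j => ((n j : ℕ) : ℤ))

/-- The Fermi variety `F_λ(V)`. -/
def FermiVariety {d : ℕ} (q : Fin d → ℕ+) (V : (Fin d → ℤ) → ℂ) (lam : ℂ) :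
    Set (Fin d → ℂ) :=
  {k | ∃ u : (Fin d → ℤ) → ℂ, u ≠ 0 ∧
    (∀ n, -(discLap u n) + V n * u n = lam * u n) ∧
    (∀ (n : Fin d → ℤ) (j : Fin d),
      u (Function.update n j (n j + ((q j : ℕ) : ℤ)))
        = Complex.exp (2 * (Real.pi : ℂ) * Complex.I * k j) * u n)}

/-- Floquet isospectrality of two real periodic potentials. -/
def FloquetIso {d : ℕ} (q : Fin d → ℕ+) (V Y : (Fin d → ℤ) → ℝ) : Prop :=
  ∀ k : Fin d → ℝ,
    spectrum ℂ (DVmat q (fun n => ((V n : ℝ) : ℂ))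
        (fun j => Complex.exp (2 * (Real.pi : ℂ) * Complex.I * (k j : ℂ))))
      = spectrum ℂ (DVmat q (fun n => ((Y n : ℝ) : ℂ))
        (fun j => Complex.exp (2 * (Real.pi : ℂ) * Complex.I * (k j : ℂ))))

/-- A function on `(ℂ^*)^d` given by a Laurent polynomial. -/
def IsLaurent {d : ℕ} (f : (Fin d → ℂ) → ℂ) : Prop :=
  ∃ c : (Fin d → ℤ) →₀ ℂ, ∀ z : Fin d → ℂ, (∀ j, z j ≠ 0) →
    f z = c.sum fun a C => C * ∏ j, z j ^ a j

/-- A Laurent monomial `C z₁^{a₁} ⋯ z_d^{a_d}` with `C ≠ 0`. -/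
def IsMonomial {d : ℕ} (f : (Fin d → ℂ) → ℂ) : Prop :=
  ∃ (C : ℂ) (a : Fin d → ℤ), C ≠ 0 ∧ ∀ z : Fin d → ℂ, (∀ j, z j ≠ 0) →
    f z = C * ∏ j, z j ^ a j

/-- Irreducibility of a Laurent polynomial: no factorization into two non-monomial
Laurent polynomials. -/
def LaurentIrreducible {d : ℕ} (h : (Fin d → ℂ) → ℂ) : Prop :=
  ¬ ∃ f g : (Fin d → ℂ) → ℂ, IsLaurent f ∧ IsLaurent g ∧
      ¬ IsMonomial f ∧ ¬ IsMonomial g ∧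
      ∀ z : Fin d → ℂ, (∀ j, z j ≠ 0) → h z = f z * g z

/-- The quadratic matrix polynomial `X² A + X S + B`. -/
def quadPencil {n : Type*} (A S B : Matrix n n ℂ) : Matrix n n (Polynomial ℂ) :=
  Matrix.of fun i j => Polynomial.C (A i j) * Polynomial.X ^ 2 +
    Polynomial.C (S i j) * Polynomial.X + Polynomial.C (B i j)

lemma eval_det_quadPencil {n : Type*} [Fintype n] [DecidableEq n] (A S B : Matrix n n ℂ) (x : ℂ) :
    (quadPencil A S B).det.eval x = (x ^ 2 • A + x • S + B).det := by
  rw [← Polynomial.coe_evalRingHom, RingHom.map_det]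
  congr 1
  ext i j
  simp only [quadPencil, RingHom.mapMatrix_apply, Matrix.map_apply, Matrix.of_apply,
    Polynomial.coe_evalRingHom, Polynomial.eval_add, Polynomial.eval_mul, Polynomial.eval_C,
    Polynomial.eval_pow, Polynomial.eval_X, Matrix.add_apply, Matrix.smul_apply, smul_eq_mul]
  ring

lemma natDegree_det_quadPencil_le {n : Type*} [Fintype n] [DecidableEq n] (A S B : Matrix n n ℂ) :
    (quadPencil A S B).det.natDegree ≤ Fintype.card n * 2 := by
  rw [Matrix.det_apply]
  refine Polynomial.natDegree_sum_le_of_forall_le _ _ fun σ _ => ?_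
  refine (Polynomial.natDegree_smul_le _ _).trans ((Polynomial.natDegree_prod_le _ _).trans ?_)
  refine (Finset.sum_le_card_nsmul _ _ 2 fun i _ => ?_).trans (by simp)
  exact Polynomial.natDegree_quadratic_le

lemma coeff_det_quadPencil {n : Type*} [Fintype n] [DecidableEq n] (A S B : Matrix n n ℂ) :
    (quadPencil A S B).det.coeff (Fintype.card n * 2) = A.det := by
  rw [Matrix.det_apply, Matrix.det_apply, Polynomial.finsetSum_coeff]
  refine Finset.sum_congr rfl fun σ _ => ?_
  rw [Polynomial.coeff_smul, ← Finset.card_univ, Polynomial.coeff_prod_of_natDegree_le]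
  · simp [quadPencil]
  · exact fun i _ => Polynomial.natDegree_quadratic_le

lemma natDegree_det_quadPencil {n : Type*} [Fintype n] [DecidableEq n] {A : Matrix n n ℂ}
    (hA : A.det ≠ 0) (S B : Matrix n n ℂ) :
    (quadPencil A S B).det.natDegree = Fintype.card n * 2 :=
  Polynomial.natDegree_eq_of_le_of_coeff_ne_zero (natDegree_det_quadPencil_le A S B)
    (by rwa [coeff_det_quadPencil])

/-- A complex polynomial that is small at `y` has a root close to `y`. -/
lemma Polynomial.exists_root_norm_sub_lt (p : Polynomial ℂ) (y : ℂ) {ε : ℝ} (hε : 0 < ε)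
    (h : ‖p.eval y‖ < ‖p.leadingCoeff‖ * ε ^ p.natDegree) :
    ∃ x, ‖x - y‖ < ε ∧ p.eval x = 0 := by
  by_contra! hne
  have hp : p ≠ 0 := by
    rintro rfl
    simp at h
  refine h.not_ge ?_
  have hs := IsAlgClosed.splits p
  rw [hs.eval_eq_prod_roots, norm_mul, hs.natDegree_eq_card_roots]
  refine mul_le_mul_of_nonneg_left ?_ (norm_nonneg _)
  have key : ∀ s : Multiset ℂ, (∀ r ∈ s, ε ≤ ‖y - r‖) →
      ε ^ s.card ≤ ‖(s.map fun r => y - r).prod‖ := by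
    intro s
    induction s using Multiset.induction_on with
    | empty => simp
    | cons a s ih =>
      intro hs
      rw [Multiset.card_cons, Multiset.map_cons, Multiset.prod_cons, norm_mul, pow_succ']
      exact mul_le_mul (hs a (Multiset.mem_cons_self a s))
        (ih fun r hr => hs r (Multiset.mem_cons_of_mem hr)) (by positivity) (norm_nonneg _)
  refine key _ fun r hr => ?_
  by_contra! hlt
  exact hne r (by rwa [norm_sub_rev]) ((Polynomial.mem_roots hp).1 hr)

open Filter Topology in
/-- If `R t ∼ t R∞` and `y A + R∞` is singular, then `x² A + x R t + B` is singular for some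
`x ∼ t y`. -/
lemma eventually_exists_root_near {n : Type*} [Fintype n] [DecidableEq n] {A B : Matrix n n ℂ}
    (hA : A.det ≠ 0) {R : ℕ → Matrix n n ℂ} {Rlim : Matrix n n ℂ}
    (hR : Tendsto (fun t : ℕ => (t : ℂ)⁻¹ • R t) atTop (𝓝 Rlim)) {y : ℂ}
    (hy : (y • A + Rlim).det = 0) {ε : ℝ} (hε : 0 < ε) :
    ∀ᶠ t : ℕ in atTop, ∃ x : ℂ, ‖x / t - y‖ < ε ∧ (x ^ 2 • A + x • R t + B).det = 0 := by
  have hinv : Tendsto (fun t : ℕ => (t : ℂ)⁻¹) atTop (𝓝 0) :=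
    tendsto_inv_atTop_nhds_zero_nat (𝕜 := ℂ)
  have hlim : Tendsto (fun t : ℕ =>
      (y ^ 2 • A + y • ((t : ℂ)⁻¹ • R t) + ((t : ℂ)⁻¹ * (t : ℂ)⁻¹) • B).det) atTop (𝓝 0) := by
    have h1 : Tendsto (fun t : ℕ =>
        y ^ 2 • A + y • ((t : ℂ)⁻¹ • R t) + ((t : ℂ)⁻¹ * (t : ℂ)⁻¹) • B) atTop
        (𝓝 (y ^ 2 • A + y • Rlim + ((0 : ℂ) * 0) • B)) :=
      ((tendsto_const_nhds).add (hR.const_smul y)).add ((hinv.mul hinv).smul_const B)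
    have h2 := (Continuous.matrix_det continuous_id).continuousAt.tendsto.comp h1
    have h3 : (y ^ 2 • A + y • Rlim + ((0 : ℂ) * 0) • B).det = 0 := by
      have : y ^ 2 • A + y • Rlim + ((0 : ℂ) * 0) • B = y • (y • A + Rlim) := by
        rw [smul_add, smul_smul, pow_two]; simp
      rw [this, Matrix.det_smul, hy, mul_zero]
    simp only [id_eq, h3] at h2
    exact h2
  have hpos : 0 < ‖A.det‖ * ε ^ (Fintype.card n * 2) := by positivity
  have hsmall := (hlim.norm.eventually_lt_const (by simpa using hpos))
  filter_upwards [hsmall, eventually_gt_atTop 0] with t ht ht0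
  have htc : (t : ℂ) ≠ 0 := by exact_mod_cast ht0.ne'
  obtain ⟨x, hx, hx0⟩ := Polynomial.exists_root_norm_sub_lt
    (quadPencil A ((t : ℂ)⁻¹ • R t) (((t : ℂ)⁻¹ * (t : ℂ)⁻¹) • B)).det y hε (by
      rw [Polynomial.leadingCoeff, natDegree_det_quadPencil hA, coeff_det_quadPencil,
        eval_det_quadPencil]
      exact ht)
  refine ⟨t * x, by rwa [mul_div_cancel_left₀ _ htc], ?_⟩
  rw [eval_det_quadPencil] at hx0
  have : (t * x : ℂ) ^ 2 • A + (t * x : ℂ) • R t + B = ((t : ℂ) ^ 2) •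
      (x ^ 2 • A + x • ((t : ℂ)⁻¹ • R t) + ((t : ℂ)⁻¹ * (t : ℂ)⁻¹) • B) := by
    simp only [smul_add, smul_smul]
    congr 2
    · congr 1; ring
    · congr 1; field_simp
    · have : (t : ℂ) ^ 2 * ((t : ℂ)⁻¹ * (t : ℂ)⁻¹) = 1 := by field_simp
      rw [this, one_smul]
  rw [this, Matrix.det_smul, hx0, mul_zero]

lemma det_quadratic_inv {n : Type*} [Fintype n] [DecidableEq n] (A S B : Matrix n n ℂ) {x : ℂ}
    (hx : x ≠ 0) (h : (x ^ 2 • A + x • S + B).det = 0) :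
    (x⁻¹ ^ 2 • B + x⁻¹ • S + A).det = 0 := by
  have : x⁻¹ ^ 2 • B + x⁻¹ • S + A = x⁻¹ ^ 2 • (x ^ 2 • A + x • S + B) := by
    simp only [smul_add, smul_smul]
    have h1 : x⁻¹ ^ 2 * x ^ 2 = 1 := by field_simp
    have h2 : x⁻¹ ^ 2 * x = x⁻¹ := by field_simp
    rw [h1, h2, one_smul]
    abel
  rw [this, Matrix.det_smul, h, mul_zero]

/-- Two polynomials `det (x² A + x R + B)` and `det (x² A + x R' + B)` agree as soon as the first
has the maximal number of distinct roots and these are roots of the second. -/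
lemma det_quadratic_eq_of_roots {n ι : Type*} [Fintype n] [DecidableEq n] [Fintype ι]
    [Nonempty n] (A R R' B : Matrix n n ℂ) {f : ι → ℂ}
    (hf : Function.Injective f) (hcard : Fintype.card n * 2 ≤ Fintype.card ι)
    (h : ∀ i, (f i ^ 2 • A + f i • R + B).det = 0)
    (h' : ∀ i, (f i ^ 2 • A + f i • R' + B).det = 0) (x : ℂ) :
    (x ^ 2 • A + x • R + B).det = (x ^ 2 • A + x • R' + B).det := by
  have hdeg : ((quadPencil A R B).det - (quadPencil A R' B).det).natDegree
      < Fintype.card n * 2 := by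
    have hpos : 0 < Fintype.card n * 2 := by positivity
    have hle : ((quadPencil A R B).det - (quadPencil A R' B).det).natDegree
        ≤ Fintype.card n * 2 :=
      (Polynomial.natDegree_sub_le _ _).trans
        (max_le (natDegree_det_quadPencil_le _ _ _) (natDegree_det_quadPencil_le _ _ _))
    refine lt_of_le_of_ne hle fun heq => ?_
    have hc : ((quadPencil A R B).det - (quadPencil A R' B).det).coeff (Fintype.card n * 2) = 0 := by
      rw [Polynomial.coeff_sub, coeff_det_quadPencil, coeff_det_quadPencil, sub_self]
    rw [← heq, Polynomial.coeff_natDegree, Polynomial.leadingCoeff_eq_zero] at hc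
    rw [hc, Polynomial.natDegree_zero] at heq
    omega
  have hz := Polynomial.eq_zero_of_natDegree_lt_card_of_eval_eq_zero _ hf (fun i => by
    rw [Polynomial.eval_sub, eval_det_quadPencil, eval_det_quadPencil, h, h', sub_self])
    (hdeg.trans_le hcard)
  rw [← eval_det_quadPencil, ← eval_det_quadPencil, sub_eq_zero.1 hz]

open Filter Topology in
lemma eventually_det_quadratic_eq {n : Type*} [Fintype n] [DecidableEq n] [Nonempty n]
    {A B : Matrix n n ℂ} (hA : A.det ≠ 0) (hB : B.det ≠ 0)
    {R R' : ℕ → Matrix n n ℂ} {Rlim : Matrix n n ℂ}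
    (hR : Tendsto (fun t : ℕ => (t : ℂ)⁻¹ • R t) atTop (𝓝 Rlim))
    {y : n → ℂ} (hy : Function.Injective y) (hy0 : ∀ i, y i ≠ 0)
    (hyA : ∀ i, (y i • A + Rlim).det = 0) (hyB : ∀ i, (y i • B + Rlim).det = 0)
    (hroots : ∀ᶠ t in atTop, ∀ x : ℂ, x ≠ 0 → (x ^ 2 • A + x • R t + B).det = 0 →
      (x ^ 2 • A + x • R' t + B).det = 0) :
    ∀ᶠ t in atTop, ∀ x : ℂ,
      (x ^ 2 • A + x • R t + B).det = (x ^ 2 • A + x • R' t + B).det := by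
  obtain ⟨ε, ⟨hε1, hε2⟩, hε⟩ : ∃ ε : ℝ, ((∀ i, 2 * ε ≤ ‖y i‖) ∧
      ∀ i j, i ≠ j → 2 * ε ≤ ‖y i - y j‖) ∧ 0 < ε := by
    have hsmall : ∀ c : ℝ, 0 < c → ∀ᶠ ε : ℝ in 𝓝[>] 0, 2 * ε ≤ c := fun c hc => by
      filter_upwards [nhdsWithin_le_nhds (eventually_lt_nhds (half_pos hc))] with ε h
      linarith
    refine Eventually.exists (f := 𝓝[>] (0 : ℝ)) (.and (.and ?_ ?_) self_mem_nhdsWithin)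
    · exact eventually_all.2 fun i => hsmall _ (norm_pos_iff.2 (hy0 i))
    · refine eventually_all.2 fun i => eventually_all.2 fun j => ?_
      by_cases hij : i = j
      · exact .of_forall fun _ h => absurd hij h
      · exact (hsmall _ (norm_pos_iff.2 (sub_ne_zero.2 (hy.ne hij)))).mono fun _ h _ => h
  have hbig : ∀ᶠ t : ℕ in atTop, ε⁻¹ < t :=
    tendsto_natCast_atTop_atTop.eventually_gt_atTop ε⁻¹
  filter_upwards [hroots, hbig,
    eventually_all.2 fun i => eventually_exists_root_near (B := B) hA hR (hyA i) hε,
    eventually_all.2 fun i => eventually_exists_root_near (B := A) hB hR (hyB i) hε]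
    with t hroot ht hr hs
  have ht0 : (0 : ℝ) < t := (inv_pos.2 hε).trans ht
  have htε : 1 < t * ε := by
    have := mul_lt_mul_of_pos_right ht hε
    rwa [inv_mul_cancel₀ hε.ne'] at this
  choose r hr hr0 using hr
  choose s hs hs0 using hs
  have hinj : ∀ f : n → ℂ, (∀ i, ‖f i / t - y i‖ < ε) → Function.Injective f := by
    intro f hf i j hij
    by_contra hne
    have h1 := hε2 i j hne
    have h2 : y i - y j = (f j / t - y j) - (f i / t - y i) := by rw [hij]; ring
    have h3 := norm_sub_le (f j / t - y j) (f i / t - y i)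
    rw [← h2] at h3
    linarith [hf i, hf j]
  have hlarge : ∀ f : n → ℂ, (∀ i, ‖f i / t - y i‖ < ε) → ∀ i, 1 < ‖f i‖ := by
    intro f hf i
    have h1 := norm_sub_norm_le (y i) (f i / t)
    rw [norm_sub_rev] at h1
    have h2 : ε < ‖f i / t‖ := by linarith [hε1 i, hf i]
    rw [norm_div, RCLike.norm_natCast, lt_div_iff₀ ht0] at h2
    linarith
  have hne : ∀ f : n → ℂ, (∀ i, ‖f i / t - y i‖ < ε) → ∀ i, f i ≠ 0 := fun f hf i =>
    norm_pos_iff.1 (one_pos.trans (hlarge f hf i))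
  have hF : ∀ k : n ⊕ n, Sum.elim r (fun i => (s i)⁻¹) k ≠ 0 ∧
      ((Sum.elim r (fun i => (s i)⁻¹) k) ^ 2 • A + (Sum.elim r (fun i => (s i)⁻¹) k) • R t
        + B).det = 0 := by
    rintro (i | i)
    · exact ⟨hne r hr i, hr0 i⟩
    · exact ⟨inv_ne_zero (hne s hs i), det_quadratic_inv _ _ _ (hne s hs i) (hs0 i)⟩
  refine det_quadratic_eq_of_roots A (R t) (R' t) B (f := Sum.elim r fun i => (s i)⁻¹) ?_
    (by simp [mul_two]) (fun k => (hF k).2) (fun k => hroot _ (hF k).1 (hF k).2)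
  refine (hinj r hr).sumElim (inv_injective.comp (hinj s hs)) fun i j hij => ?_
  have h1 := hlarge r hr i
  rw [hij, norm_inv] at h1
  exact (inv_lt_one_of_one_lt₀ (hlarge s hs j)).not_gt h1

section Symbol

variable {d : ℕ} (q : Fin d → ℕ+)

/-- The inclusion of the fundamental domain into `ℤ^d`. -/
def domCoe (n : ∀ j, Fin (q j : ℕ)) : Fin d → ℤ := fun j => ((n j : ℕ) : ℤ)

/-- Reduction of a lattice point to the fundamental domain. -/
def domRed (m : Fin d → ℤ) : ∀ j, Fin (q j : ℕ) := fun j => fem (q j) (m j)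

/-- The Laurent monomial `w^m`. -/
def zmonomial (w : Fin d → ℂ) (m : Fin d → ℤ) : ℂ := ∏ j, w j ^ m j

/-- Cyclic translation by `s` in the `j`-th coordinate of the fundamental domain. -/
def shiftMat (j : Fin d) (s : ℤ) : Matrix (∀ j, Fin (q j : ℕ)) (∀ j, Fin (q j : ℕ)) ℂ :=
  Matrix.of fun n n' =>
    if domRed q (Function.update (domCoe q n) j (domCoe q n j + s)) = n' then 1 else 0

/-- The part of `floquetSymbol` coming from the coordinates in `s` and the potential. -/
def partialSymbol (V : (Fin d → ℤ) → ℂ) (lam : ℂ) (s : Finset (Fin d)) (w : Fin d → ℂ) :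
    Matrix (∀ j, Fin (q j : ℕ)) (∀ j, Fin (q j : ℕ)) ℂ :=
  ∑ j ∈ s, (w j • shiftMat q j 1 + (w j)⁻¹ • shiftMat q j (-1))
    + Matrix.diagonal fun n => lam - V (domCoe q n)

/-- The matrix of `λ + Δ - V` acting on functions `n ↦ w^n v(n)` with `v` periodic. -/
def floquetSymbol (V : (Fin d → ℤ) → ℂ) (lam : ℂ) (w : Fin d → ℂ) :
    Matrix (∀ j, Fin (q j : ℕ)) (∀ j, Fin (q j : ℕ)) ℂ :=
  partialSymbol q V lam Finset.univ w

variable {q}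

lemma coe_fem (p : ℕ+) (a : ℤ) : ((fem p a : ℕ) : ℤ) = a % ((p : ℕ) : ℤ) :=
  Int.toNat_of_nonneg (Int.emod_nonneg a (by exact_mod_cast p.ne_zero))

lemma fem_eq_fem {p : ℕ+} {a b : ℤ} (h : a % ((p : ℕ) : ℤ) = b % ((p : ℕ) : ℤ)) :
    fem p a = fem p b := by
  apply Fin.ext
  rw [← Int.natCast_inj, coe_fem, coe_fem, h]

lemma domCoe_domRed (m : Fin d → ℤ) : domCoe q (domRed q m) = fun j => m j % ((q j : ℕ) : ℤ) :=
  funext fun j => coe_fem (q j) (m j)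

lemma domRed_domCoe (n : ∀ j, Fin (q j : ℕ)) : domRed q (domCoe q n) = n := by
  funext j
  apply Fin.ext
  rw [← Int.natCast_inj]
  exact (coe_fem _ _).trans (Int.emod_eq_of_lt (Int.natCast_nonneg _)
    (Int.ofNat_lt.2 (n j).isLt))

lemma domRed_update_domCoe_domRed (m : Fin d → ℤ) (j : Fin d) (s : ℤ) :
    domRed q (Function.update (domCoe q (domRed q m)) j (domCoe q (domRed q m) j + s))
      = domRed q (Function.update m j (m j + s)) := by
  funext i
  refine fem_eq_fem ?_
  rw [domCoe_domRed]
  by_cases h : i = j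
  · subst h
    simp
  · simp [Function.update_of_ne h]

lemma domRed_update_add_period (m : Fin d → ℤ) (j : Fin d) :
    domRed q (Function.update m j (m j + ((q j : ℕ) : ℤ))) = domRed q m := by
  funext i
  refine fem_eq_fem ?_
  by_cases h : i = j
  · subst h
    simp
  · simp [Function.update_of_ne h]

lemma apply_domCoe_domRed {α : Type*} {f : (Fin d → ℤ) → α}
    (hf : ∀ (n : Fin d → ℤ) (j : Fin d), f (Function.update n j (n j + ((q j : ℕ) : ℤ))) = f n)
    (m : Fin d → ℤ) : f (domCoe q (domRed q m)) = f m := by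
  have hmul : ∀ (j : Fin d) (c : ℤ) (n : Fin d → ℤ),
      f (Function.update n j (n j + ((q j : ℕ) : ℤ) * c)) = f n := by
    intro j c
    induction c using Int.induction_on with
    | zero => simp
    | succ c ih =>
      intro n
      rw [← ih n, ← hf (Function.update n j (n j + ((q j : ℕ) : ℤ) * c)) j]
      simp [mul_add, add_assoc]
    | pred c ih =>
      intro n
      rw [← ih n, ← hf (Function.update n j (n j + ((q j : ℕ) : ℤ) * (-c - 1))) j]
      simp [mul_sub, add_assoc]
  have hset : ∀ s : Finset (Fin d),
      f (fun j => if j ∈ s then m j % ((q j : ℕ) : ℤ) else m j) = f m := by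
    intro s
    induction s using Finset.induction_on with
    | empty => simp
    | insert i s hi ih =>
      rw [← ih, ← hmul i (-(m i / ((q i : ℕ) : ℤ))) fun j =>
        if j ∈ s then m j % ((q j : ℕ) : ℤ) else m j]
      congr 1
      funext j
      by_cases h : j = i
      · subst h
        simp [hi, Int.emod_def, sub_eq_add_neg]
      · simp [h]
  simpa [domCoe_domRed] using hset Finset.univ

lemma zmonomial_ne_zero {w : Fin d → ℂ} (hw : ∀ j, w j ≠ 0) (m : Fin d → ℤ) :
    zmonomial w m ≠ 0 :=
  Finset.prod_ne_zero_iff.2 fun j _ => zpow_ne_zero _ (hw j)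

lemma zmonomial_update {w : Fin d → ℂ} (hw : ∀ j, w j ≠ 0) (m : Fin d → ℤ) (j : Fin d) (s : ℤ) :
    zmonomial w (Function.update m j (m j + s)) = zmonomial w m * w j ^ s := by
  unfold zmonomial
  rw [← Finset.mul_prod_erase _ _ (Finset.mem_univ j),
    ← Finset.mul_prod_erase _ _ (Finset.mem_univ j), Function.update_self, zpow_add₀ (hw j)]
  have : ∏ x ∈ Finset.univ.erase j, w x ^ Function.update m j (m j + s) x
      = ∏ x ∈ Finset.univ.erase j, w x ^ m x :=
    Finset.prod_congr rfl fun x hx => by rw [Function.update_of_ne (Finset.ne_of_mem_erase hx)]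
  rw [this]
  ring

lemma shiftMat_mulVec (j : Fin d) (s : ℤ) (v : (∀ j, Fin (q j : ℕ)) → ℂ)
    (n : ∀ j, Fin (q j : ℕ)) : (shiftMat q j s).mulVec v n
      = v (domRed q (Function.update (domCoe q n) j (domCoe q n j + s))) := by
  simp [Matrix.mulVec, dotProduct, shiftMat]

lemma det_shiftMat_ne_zero (j : Fin d) (s : ℤ) : (shiftMat q j s).det ≠ 0 := by
  intro h
  obtain ⟨v, hv, hv0⟩ := Matrix.exists_mulVec_eq_zero_iff.2 h
  refine hv (funext fun n => ?_)
  have := congrFun hv0 (domRed q (Function.update (domCoe q n) j (domCoe q n j + -s)))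
  rw [shiftMat_mulVec, domRed_update_domCoe_domRed] at this
  simpa [domRed_domCoe] using this

lemma floquetSymbol_mulVec (V : (Fin d → ℤ) → ℂ) (lam : ℂ) (w : Fin d → ℂ)
    (v : (∀ j, Fin (q j : ℕ)) → ℂ) (n : ∀ j, Fin (q j : ℕ)) :
    (floquetSymbol q V lam w).mulVec v n
      = ∑ j, (w j * v (domRed q (Function.update (domCoe q n) j (domCoe q n j + 1)))
          + (w j)⁻¹ * v (domRed q (Function.update (domCoe q n) j (domCoe q n j + -1))))
        + (lam - V (domCoe q n)) * v n := by
  simp only [floquetSymbol, partialSymbol, Matrix.add_mulVec, Matrix.sum_mulVec,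
    Matrix.smul_mulVec, Pi.add_apply, Finset.sum_apply, Pi.smul_apply, shiftMat_mulVec,
    Matrix.mulVec_diagonal, smul_eq_mul]

/-- Conjugating `λ + Δ - V` by `w^m` gives the Floquet symbol. -/
lemma discLap_zmonomial_mul {V : (Fin d → ℤ) → ℂ} (hV : IsPeriodic q V) (lam : ℂ)
    {w : Fin d → ℂ} (hw : ∀ j, w j ≠ 0) (v : (∀ j, Fin (q j : ℕ)) → ℂ) (m : Fin d → ℤ) :
    discLap (fun m => zmonomial w m * v (domRed q m)) m
        + (lam - V m) * (zmonomial w m * v (domRed q m))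
      = zmonomial w m * (floquetSymbol q V lam w).mulVec v (domRed q m) := by
  rw [floquetSymbol_mulVec, apply_domCoe_domRed hV, discLap, mul_add, Finset.mul_sum]
  congr 1
  · refine Finset.sum_congr rfl fun j _ => ?_
    simp only [domRed_update_domCoe_domRed, sub_eq_add_neg, zmonomial_update hw, zpow_one,
      zpow_neg]
    ring
  · ring

lemma zmonomial_update_period {w : Fin d → ℂ} (hw : ∀ j, w j ≠ 0) {k : Fin d → ℂ}
    (hk : ∀ j, Complex.exp (2 * (Real.pi : ℂ) * Complex.I * k j) = w j ^ (q j : ℕ))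
    (m : Fin d → ℤ) (j : Fin d) :
    zmonomial w (Function.update m j (m j + ((q j : ℕ) : ℤ)))
      = Complex.exp (2 * (Real.pi : ℂ) * Complex.I * k j) * zmonomial w m := by
  rw [zmonomial_update hw, hk, zpow_natCast, mul_comm]

lemma mem_FermiVariety_iff {V : (Fin d → ℤ) → ℂ} (hV : IsPeriodic q V) (lam : ℂ)
    {w : Fin d → ℂ} (hw : ∀ j, w j ≠ 0) {k : Fin d → ℂ}
    (hk : ∀ j, Complex.exp (2 * (Real.pi : ℂ) * Complex.I * k j) = w j ^ (q j : ℕ)) :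
    k ∈ FermiVariety q V lam ↔ (floquetSymbol q V lam w).det = 0 := by
  rw [← Matrix.exists_mulVec_eq_zero_iff]
  constructor
  · rintro ⟨u, hu, heq, hper⟩
    have hperiodic : ∀ (m : Fin d → ℤ) (j : Fin d),
        (zmonomial w (Function.update m j (m j + ((q j : ℕ) : ℤ))))⁻¹
          * u (Function.update m j (m j + ((q j : ℕ) : ℤ))) = (zmonomial w m)⁻¹ * u m := by
      intro m j
      have h1 := zmonomial_ne_zero hw m
      have h2 : Complex.exp (2 * (Real.pi : ℂ) * Complex.I * k j) ≠ 0 := Complex.exp_ne_zero _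
      rw [zmonomial_update_period hw hk, hper]
      field_simp
    have hu' : u = fun m => zmonomial w m *
        (fun n => (zmonomial w (domCoe q n))⁻¹ * u (domCoe q n)) (domRed q m) := by
      funext m
      have := apply_domCoe_domRed (f := fun m => (zmonomial w m)⁻¹ * u m) hperiodic m
      simp only at this ⊢
      rw [this, mul_inv_cancel_left₀ (zmonomial_ne_zero hw m)]
    refine ⟨fun n => (zmonomial w (domCoe q n))⁻¹ * u (domCoe q n), ?_, ?_⟩
    · intro h
      refine hu ?_
      rw [hu', h]
      simp
      rfl
    · funext n
      have h := discLap_zmonomial_mul hV lam hw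
        (fun n => (zmonomial w (domCoe q n))⁻¹ * u (domCoe q n)) (domCoe q n)
      have hm := congrFun hu' (domCoe q n)
      rw [← hu', ← hm, domRed_domCoe] at h
      have h0 : discLap u (domCoe q n) + (lam - V (domCoe q n)) * u (domCoe q n) = 0 := by
        linear_combination -(heq (domCoe q n))
      rw [h0] at h
      exact (mul_eq_zero.1 h.symm).resolve_left (zmonomial_ne_zero hw _)
  · rintro ⟨v, hv, hv0⟩
    refine ⟨fun m => zmonomial w m * v (domRed q m), fun h => hv (funext fun n => ?_),
      fun m => ?_, fun m j => ?_⟩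
    · have := congrFun h (domCoe q n)
      simpa [zmonomial_ne_zero hw, domRed_domCoe] using this
    · have h := discLap_zmonomial_mul hV lam hw v m
      rw [hv0, Pi.zero_apply, mul_zero] at h
      linear_combination -h
    · simp only
      rw [zmonomial_update_period hw hk, domRed_update_add_period, mul_assoc]

lemma extendBC_pow_single {w : Fin d → ℂ} (hw : ∀ j, w j ≠ 0) (n' : ∀ j, Fin (q j : ℕ))
    (m : Fin d → ℤ) :
    extendBC q (fun j => w j ^ (q j : ℕ)) (Pi.single n' 1) m * zmonomial w (domCoe q n')
      = zmonomial w m * if domRed q m = n' then 1 else 0 := by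
  by_cases h : domRed q m = n'
  · have h' : (fun j => fem (q j) (m j)) = n' := h
    rw [if_pos h, mul_one, extendBC, h', Pi.single_eq_same, mul_one, ← h, domCoe_domRed]
    simp only [zmonomial]
    rw [← Finset.prod_mul_distrib]
    refine Finset.prod_congr rfl fun j _ => ?_
    rw [← zpow_natCast, ← zpow_mul, ← zpow_add₀ (hw j), Int.mul_ediv_add_emod]
  · have h' : (fun j => fem (q j) (m j)) ≠ n' := h
    rw [if_neg h, extendBC, Pi.single_eq_of_ne h']
    ring

lemma scriptP_pow (V : (Fin d → ℤ) → ℂ) (lam : ℂ) {w : Fin d → ℂ} (hw : ∀ j, w j ≠ 0) :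
    scriptP q V (fun j => w j ^ (q j : ℕ)) lam = (-floquetSymbol q V lam w).det := by
  have hconj : (DVmat q V (fun j => w j ^ (q j : ℕ)) - lam • 1)
        * Matrix.diagonal (fun n => zmonomial w (domCoe q n))
      = Matrix.diagonal (fun n => zmonomial w (domCoe q n)) * -floquetSymbol q V lam w := by
    ext n n'
    rw [Matrix.mul_diagonal, Matrix.diagonal_mul]
    have hlap : discLap (extendBC q (fun j => w j ^ (q j : ℕ)) (Pi.single n' 1)) (domCoe q n)
          * zmonomial w (domCoe q n')
        = zmonomial w (domCoe q n) * ∑ j, (w j * shiftMat q j 1 n n'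
          + (w j)⁻¹ * shiftMat q j (-1) n n') := by
      rw [discLap, Finset.sum_mul, Finset.mul_sum]
      refine Finset.sum_congr rfl fun j _ => ?_
      rw [add_mul, extendBC_pow_single hw, extendBC_pow_single hw, sub_eq_add_neg,
        zmonomial_update hw, zmonomial_update hw]
      simp only [shiftMat, Matrix.of_apply, zpow_one, zpow_neg]
      ring
    have hdiag : zmonomial w (domCoe q n') * (if n = n' then 1 else 0)
        = zmonomial w (domCoe q n) * (if n = n' then 1 else 0) := by
      split_ifs with h
      · rw [h]
      · simp
    have hsym : floquetSymbol q V lam w n n' = ∑ j, (w j * shiftMat q j 1 n n'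
          + (w j)⁻¹ * shiftMat q j (-1) n n') + (lam - V (domCoe q n)) * if n = n' then 1 else 0 := by
      simp [floquetSymbol, partialSymbol, Matrix.sum_apply, Matrix.diagonal_apply]
    have hD : (DVmat q V (fun j => w j ^ (q j : ℕ)) - lam • 1) n n'
        = -discLap (extendBC q (fun j => w j ^ (q j : ℕ)) (Pi.single n' 1)) (domCoe q n)
          + (V (domCoe q n) - lam) * if n = n' then 1 else 0 := by
      simp only [DVmat, Matrix.sub_apply, Matrix.smul_apply, Matrix.one_apply, smul_eq_mul]
      rw [sub_mul, ← add_sub_assoc]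
      rfl
    rw [hD, Matrix.neg_apply, hsym]
    linear_combination -hlap + (V (domCoe q n) - lam) * hdiag
  have hdet := congrArg Matrix.det hconj
  rw [Matrix.det_mul, Matrix.det_mul, mul_comm] at hdet
  refine mul_left_cancel₀ ?_ hdet
  rw [Matrix.det_diagonal]
  exact Finset.prod_ne_zero_iff.2 fun n _ => zmonomial_ne_zero hw _

lemma smul_floquetSymbol (V : (Fin d → ℤ) → ℂ) (lam : ℂ) {w : Fin d → ℂ} (j : Fin d)
    (hw : w j ≠ 0) :
    w j • floquetSymbol q V lam w = w j ^ 2 • shiftMat q j 1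
      + w j • partialSymbol q V lam (Finset.univ.erase j) w + shiftMat q j (-1) := by
  rw [floquetSymbol, partialSymbol, partialSymbol,
    ← Finset.add_sum_erase _ _ (Finset.mem_univ j)]
  simp only [smul_add, smul_smul, mul_inv_cancel₀ hw, one_smul, pow_two]
  abel

/-- Characters of the finite torus are joint eigenvectors of the translations. -/
lemma det_sum_shiftMat_eq_zero {ζ : Fin d → ℂ} (hζ : ∀ j, ζ j ^ (q j : ℕ) = 1) (ε : Fin d → ℤ)
    (c : Fin d → ℂ) (h : ∑ j, c j * ζ j ^ ε j = 0) :
    (∑ j, c j • shiftMat q j (ε j)).det = 0 := by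
  have hζ0 : ∀ j, ζ j ≠ 0 := fun j h0 => by
    have := hζ j
    rw [h0, zero_pow (q j).ne_zero] at this
    exact zero_ne_one this
  have hper : ∀ (m : Fin d → ℤ) (j : Fin d),
      zmonomial ζ (Function.update m j (m j + ((q j : ℕ) : ℤ))) = zmonomial ζ m := fun m j => by
    rw [zmonomial_update hζ0, zpow_natCast, hζ, mul_one]
  refine Matrix.exists_mulVec_eq_zero_iff.1 ⟨fun n => zmonomial ζ (domCoe q n), fun h0 => ?_, ?_⟩
  · exact zmonomial_ne_zero hζ0 _ (congrFun h0 (domRed q 0))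
  · funext n
    simp only [Matrix.sum_mulVec, Finset.sum_apply, Matrix.smul_mulVec, Pi.smul_apply,
      shiftMat_mulVec, smul_eq_mul, Pi.zero_apply, apply_domCoe_domRed hper,
      zmonomial_update hζ0]
    rw [← mul_zero (zmonomial ζ (domCoe q n)), ← h, Finset.mul_sum]
    exact Finset.sum_congr rfl fun j _ => by ring

lemma det_smul_shiftMat_add_sum_eq_zero {ζ : Fin d → ℂ} (hζ : ∀ j, ζ j ^ (q j : ℕ) = 1)
    (j₀ : Fin d) (s : ℤ) (y : ℂ) (g : Fin d → ℂ)
    (h : y * ζ j₀ ^ s + ∑ j ∈ Finset.univ.erase j₀, g j * ζ j = 0) :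
    (y • shiftMat q j₀ s + ∑ j ∈ Finset.univ.erase j₀, g j • shiftMat q j 1).det = 0 := by
  have hne : ∀ j ∈ Finset.univ.erase j₀, j ≠ j₀ := fun j hj => Finset.ne_of_mem_erase hj
  rw [← det_sum_shiftMat_eq_zero hζ (Function.update 1 j₀ s) (Function.update g j₀ y)]
  · congr 1
    rw [← Finset.add_sum_erase _ _ (Finset.mem_univ j₀)]
    simp only [Function.update_self]
    congr 1
    exact Finset.sum_congr rfl fun j hj => by simp [hne j hj]
  · rw [← h, ← Finset.add_sum_erase _ _ (Finset.mem_univ j₀)]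
    simp only [Function.update_self]
    congr 1
    exact Finset.sum_congr rfl fun j hj => by simp [hne j hj]

variable (q) in
/-- The root of unity `e^{2πi n_j / q_j}`. -/
def torusRoot (n : ∀ j, Fin (q j : ℕ)) (j : Fin d) : ℂ :=
  Complex.exp (2 * Real.pi * Complex.I / (q j : ℕ)) ^ (n j : ℕ)

lemma torusRoot_pow (n : ∀ j, Fin (q j : ℕ)) (j : Fin d) : torusRoot q n j ^ (q j : ℕ) = 1 := by
  rw [torusRoot, pow_right_comm,
    (Complex.isPrimitiveRoot_exp _ (q j).ne_zero).pow_eq_one, one_pow]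

lemma torusRoot_ne_zero (n : ∀ j, Fin (q j : ℕ)) (j : Fin d) : torusRoot q n j ≠ 0 :=
  pow_ne_zero _ (Complex.exp_ne_zero _)

lemma torusRoot_injective : Function.Injective (torusRoot q) := fun n m h => by
  funext j
  exact Fin.ext ((Complex.isPrimitiveRoot_exp _ (q j).ne_zero).pow_inj (n j).isLt (m j).isLt
    (congrFun h j))

/-- The products `ζ_{j₀} ζ_j` with `j ≠ j₀` determine a point of the torus when the periods are
coprime. -/
lemma eq_of_torusRoot_mul_eq (hq : ∀ i j, i ≠ j → Nat.Coprime (q i) (q j)) {j₀ j₁ : Fin d}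
    (hj : j₁ ≠ j₀) {n m : ∀ j, Fin (q j : ℕ)}
    (h : ∀ j, j ≠ j₀ → torusRoot q n j₀ * torusRoot q n j = torusRoot q m j₀ * torusRoot q m j) :
    n = m := by
  have h0 : torusRoot q n j₀ = torusRoot q m j₀ := by
    have h1 : (torusRoot q n j₀ / torusRoot q m j₀) ^ (q j₀ : ℕ) = 1 := by
      rw [div_pow, torusRoot_pow, torusRoot_pow, div_one]
    have h2 : (torusRoot q n j₀ / torusRoot q m j₀) ^ (q j₁ : ℕ) = 1 := by
      have : torusRoot q n j₀ / torusRoot q m j₀ = torusRoot q m j₁ / torusRoot q n j₁ := by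
        rw [div_eq_div_iff (torusRoot_ne_zero _ _) (torusRoot_ne_zero _ _), h j₁ hj, mul_comm]
      rw [this, div_pow, torusRoot_pow, torusRoot_pow, div_one]
    have h3 := pow_gcd_eq_one.2 ⟨h1, h2⟩
    rw [Nat.Coprime.gcd_eq_one (hq j₀ j₁ hj.symm), pow_one] at h3
    exact (div_eq_one_iff_eq (torusRoot_ne_zero _ _)).1 h3
  refine torusRoot_injective (funext fun j => ?_)
  by_cases hj' : j = j₀
  · rw [hj', h0]
  · have := h j hj'
    rw [h0] at this
    exact mul_left_cancel₀ (torusRoot_ne_zero _ _) this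

lemma exists_direction (hq : ∀ i j, i ≠ j → Nat.Coprime (q i) (q j)) {j₀ j₁ : Fin d}
    (hj : j₁ ≠ j₀) : ∃ g : Fin d → ℂ,
      (∀ n, -(torusRoot q n j₀ * ∑ j ∈ Finset.univ.erase j₀, g j * torusRoot q n j) ≠ 0) ∧
      Function.Injective fun n : ∀ j, Fin (q j : ℕ) =>
        -(torusRoot q n j₀ * ∑ j ∈ Finset.univ.erase j₀, g j * torusRoot q n j) := by
  let v : (∀ j, Fin (q j : ℕ)) → Fin d → ℂ := fun n j =>
    if j = j₀ then 0 else torusRoot q n j₀ * torusRoot q n j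
  have hv0 : ∀ n, v n ≠ 0 := fun n h => by
    have := congrFun h j₁
    simp [v, hj, torusRoot_ne_zero] at this
  have hv : Function.Injective v := fun n m h => by
    refine eq_of_torusRoot_mul_eq hq hj fun j hj' => ?_
    have := congrFun h j
    simpa [v, hj'] using this
  obtain ⟨f, hf⟩ := Module.exists_dual_forall_apply_ne_zero (K := ℂ)
    (Sum.elim v fun p : {p : (∀ j, Fin (q j : ℕ)) × (∀ j, Fin (q j : ℕ)) // p.1 ≠ p.2} =>
      v p.1.1 - v p.1.2) (by
      rintro (n | p)
      · exact hv0 n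
      · exact sub_ne_zero.2 (hv.ne p.2))
  have hfv : ∀ n, f (v n) = torusRoot q n j₀ *
      ∑ j ∈ Finset.univ.erase j₀, f (Pi.single j 1) * torusRoot q n j := fun n => by
    rw [LinearMap.pi_apply_eq_sum_univ f (v n), ← Finset.add_sum_erase _ _ (Finset.mem_univ j₀),
      Finset.mul_sum]
    have : v n j₀ = 0 := by simp [v]
    rw [this, zero_smul, zero_add]
    refine Finset.sum_congr rfl fun j hj' => ?_
    have hs : (fun i => if j = i then (1 : ℂ) else 0) = Pi.single j 1 := by
      funext i
      simp [Pi.single_apply, eq_comm]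
    rw [hs]
    simp only [v, Finset.ne_of_mem_erase hj', if_false, smul_eq_mul]
    ring
  refine ⟨fun j => f (Pi.single j 1), fun n => ?_, fun n m h => ?_⟩
  · rw [← hfv]
    exact neg_ne_zero.2 (hf (Sum.inl n))
  · by_contra hne
    have h1 := hf (Sum.inr ⟨(n, m), hne⟩)
    simp only [Sum.elim_inr, map_sub, hfv] at h1
    exact h1 (sub_eq_zero.2 (neg_injective h))

open Filter Topology in
lemma eventually_add_mul_ne_zero {a : ℂ} (ha : a ≠ 0) (g : ℂ) :
    ∀ᶠ t : ℕ in atTop, a + t * g ≠ 0 := by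
  by_cases hg : g = 0
  · simp [hg, ha]
  rw [← Nat.cofinite_eq_atTop]
  refine Set.Finite.eventually_cofinite_notMem (s := {t : ℕ | a + t * g = 0})
    (Set.Subsingleton.finite fun s hs t ht => ?_)
  have h1 : (s : ℂ) * g = t * g := by
    have h2 : a + s * g = a + t * g := Eq.trans hs (Eq.symm ht)
    exact add_left_cancel h2
  exact_mod_cast mul_right_cancel₀ hg h1

open Filter Topology in
lemma tendsto_inv_mul_add_mul (a g : ℂ) :
    Tendsto (fun t : ℕ => (t : ℂ)⁻¹ * (a + t * g)) atTop (𝓝 g) := by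
  have h := (tendsto_inv_atTop_nhds_zero_nat (𝕜 := ℂ)).mul_const a |>.add_const g
  rw [zero_mul, zero_add] at h
  refine h.congr' ?_
  filter_upwards [eventually_gt_atTop 0] with t ht
  have : (t : ℂ) ≠ 0 := by exact_mod_cast ht.ne'
  field_simp

open Filter Topology in
lemma tendsto_inv_mul_inv_add_mul (a g : ℂ) :
    Tendsto (fun t : ℕ => (t : ℂ)⁻¹ * (a + t * g)⁻¹) atTop (𝓝 0) := by
  have hinv := tendsto_inv_atTop_nhds_zero_nat (𝕜 := ℂ)
  by_cases hg : g = 0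
  · simpa [hg] using hinv.mul_const a⁻¹
  have h := (hinv.mul hinv).mul ((tendsto_inv_mul_add_mul a g).inv₀ hg)
  rw [zero_mul, zero_mul] at h
  refine h.congr' ?_
  filter_upwards [eventually_gt_atTop 0] with t ht
  have : (t : ℂ) ≠ 0 := by exact_mod_cast ht.ne'
  rw [mul_inv, inv_inv, mul_assoc, inv_mul_cancel_left₀ this]

open Filter Topology in
lemma tendsto_partialSymbol (V : (Fin d → ℤ) → ℂ) (lam : ℂ) (s : Finset (Fin d))
    (a g : Fin d → ℂ) :
    Tendsto (fun t : ℕ => (t : ℂ)⁻¹ • partialSymbol q V lam s (fun j => a j + t * g j)) atTop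
      (𝓝 (∑ j ∈ s, g j • shiftMat q j 1)) := by
  have h := (tendsto_finsetSum s fun j _ =>
      ((tendsto_inv_mul_add_mul (a j) (g j)).smul_const (shiftMat q j 1)).add
        ((tendsto_inv_mul_inv_add_mul (a j) (g j)).smul_const (shiftMat q j (-1)))).add
    ((tendsto_inv_atTop_nhds_zero_nat (𝕜 := ℂ)).smul_const
      (Matrix.diagonal fun n => lam - V (domCoe q n)))
  simp only [zero_smul, add_zero] at h
  refine h.congr fun t => ?_
  simp only [partialSymbol, smul_add, Finset.smul_sum, smul_smul]

/-- Along a complex line, the determinant of the Floquet symbol becomes polynomial after clearing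
denominators. -/
lemma exists_polynomial_det_floquetSymbol (V : (Fin d → ℤ) → ℂ) (lam : ℂ) (a g : Fin d → ℂ) :
    ∃ p : Polynomial ℂ, ∀ t : ℂ, (∀ j, a j + t * g j ≠ 0) → p.eval t
      = (∏ j, (a j + t * g j)) ^ Fintype.card (∀ j, Fin (q j : ℕ))
        * (floquetSymbol q V lam fun j => a j + t * g j).det := by
  let ℓ : Fin d → Polynomial ℂ := fun j => Polynomial.C (a j) + Polynomial.X * Polynomial.C (g j)
  have hℓ : ∀ (j : Fin d) (t : ℂ), (ℓ j).eval t = a j + t * g j := fun j t => by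
    simp only [ℓ, Polynomial.eval_add, Polynomial.eval_mul, Polynomial.eval_C, Polynomial.eval_X]
  refine ⟨Matrix.det (Matrix.of fun n n' =>
    ∑ j, ((∏ i, ℓ i) * ℓ j * Polynomial.C (shiftMat q j 1 n n')
      + (∏ i ∈ Finset.univ.erase j, ℓ i) * Polynomial.C (shiftMat q j (-1) n n'))
    + (∏ i, ℓ i) * Polynomial.C
      (Matrix.diagonal (fun n => lam - V (domCoe q n)) n n')), fun t ht => ?_⟩
  rw [← Matrix.det_smul, ← Polynomial.coe_evalRingHom, RingHom.map_det]
  congr 1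
  ext n n'
  simp only [RingHom.mapMatrix_apply, Matrix.map_apply, Matrix.of_apply,
    Polynomial.coe_evalRingHom, Polynomial.eval_add, Polynomial.eval_mul, Polynomial.eval_C,
    Polynomial.eval_finsetSum, Polynomial.eval_prod, hℓ, floquetSymbol, partialSymbol,
    Matrix.smul_apply, Matrix.add_apply, Matrix.sum_apply, smul_eq_mul]
  rw [mul_add, Finset.mul_sum]
  congr 1
  refine Finset.sum_congr rfl fun j _ => ?_
  have h := Finset.mul_prod_erase Finset.univ (fun j => a j + t * g j) (Finset.mem_univ j)
  have h' : (∏ i, (a i + t * g i)) * (a j + t * g j)⁻¹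
      = ∏ i ∈ Finset.univ.erase j, (a i + t * g i) := by
    rw [← h, mul_comm, inv_mul_cancel_left₀ (ht j)]
  rw [← h']
  ring

lemma partialSymbol_erase_update (V : (Fin d → ℤ) → ℂ) (lam : ℂ) (w : Fin d → ℂ) (j : Fin d)
    (x : ℂ) : partialSymbol q V lam (Finset.univ.erase j) (Function.update w j x)
      = partialSymbol q V lam (Finset.univ.erase j) w := by
  unfold partialSymbol
  congr 1
  exact Finset.sum_congr rfl fun i hi => by rw [Function.update_of_ne (Finset.ne_of_mem_erase hi)]

lemma exists_exp_eq_pow {w : Fin d → ℂ} (hw : ∀ j, w j ≠ 0) : ∃ k : Fin d → ℂ,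
    ∀ j, Complex.exp (2 * (Real.pi : ℂ) * Complex.I * k j) = w j ^ (q j : ℕ) := by
  refine ⟨fun j => Complex.log (w j ^ (q j : ℕ)) / (2 * (Real.pi : ℂ) * Complex.I), fun j => ?_⟩
  rw [mul_div_cancel₀ _ Complex.two_pi_I_ne_zero, Complex.exp_log (pow_ne_zero _ (hw j))]

open Filter Topology in
/-- Equality of the Fermi varieties forces equality of the determinants of the Floquet symbols. -/
lemma det_floquetSymbol_eq (hq : ∀ i j, i ≠ j → Nat.Coprime (q i) (q j)) {j₀ j₁ : Fin d}
    (hj : j₁ ≠ j₀) {V Y : (Fin d → ℤ) → ℂ} (hV : IsPeriodic q V) (hY : IsPeriodic q Y) {lam : ℂ}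
    (hiso : FermiVariety q V lam = FermiVariety q Y lam) {w : Fin d → ℂ} (hw : ∀ j, w j ≠ 0) :
    (floquetSymbol q V lam w).det = (floquetSymbol q Y lam w).det := by
  have hzero : ∀ w : Fin d → ℂ, (∀ j, w j ≠ 0) → (floquetSymbol q V lam w).det = 0 →
      (floquetSymbol q Y lam w).det = 0 := fun w hw h => by
    obtain ⟨k, hk⟩ := exists_exp_eq_pow (q := q) hw
    rw [← mem_FermiVariety_iff hY lam hw hk, ← hiso, mem_FermiVariety_iff hV lam hw hk]
    exact h
  obtain ⟨g, hg0, hg⟩ := exists_direction hq hj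
  have hne : ∀ᶠ t : ℕ in atTop, ∀ j, w j + t * g j ≠ 0 :=
    eventually_all.2 fun j => eventually_add_mul_ne_zero (hw j) (g j)
  have hnonempty : Nonempty (∀ j, Fin (q j : ℕ)) := ⟨domRed q 0⟩
  have hquad := eventually_det_quadratic_eq (det_shiftMat_ne_zero j₀ 1)
    (det_shiftMat_ne_zero j₀ (-1))
    (R' := fun t : ℕ => partialSymbol q Y lam (Finset.univ.erase j₀) fun j => w j + t * g j)
    (tendsto_partialSymbol V lam (Finset.univ.erase j₀) w g) hg hg0
    (fun n => by
      have hroot : ∀ j, Function.update (torusRoot q n) j₀ (torusRoot q n j₀)⁻¹ j ^ (q j : ℕ)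
          = 1 := fun j => by
        by_cases h : j = j₀
        · subst h
          rw [Function.update_self, inv_pow, torusRoot_pow, inv_one]
        · rw [Function.update_of_ne h, torusRoot_pow]
      refine det_smul_shiftMat_add_sum_eq_zero hroot j₀ 1 _ g ?_
      have hsum : ∑ j ∈ Finset.univ.erase j₀,
            g j * Function.update (torusRoot q n) j₀ (torusRoot q n j₀)⁻¹ j
          = ∑ j ∈ Finset.univ.erase j₀, g j * torusRoot q n j :=
        Finset.sum_congr rfl fun j hj => by
          rw [Function.update_of_ne (Finset.ne_of_mem_erase hj)]
      rw [hsum, Function.update_self, zpow_one]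
      have := torusRoot_ne_zero n j₀
      field_simp
      ring)
    (fun n => by
      refine det_smul_shiftMat_add_sum_eq_zero (torusRoot_pow n) j₀ (-1) _ g ?_
      have := torusRoot_ne_zero n j₀
      rw [zpow_neg_one]
      field_simp
      ring)
    (by
      filter_upwards [hne] with t ht x hx h
      have hw' : ∀ j, Function.update (fun j => w j + t * g j) j₀ x j ≠ 0 := fun j => by
        by_cases h : j = j₀
        · subst h
          rwa [Function.update_self]
        · rw [Function.update_of_ne h]
          exact ht j
      have hV' := smul_floquetSymbol (q := q) V lam j₀ (hw' j₀)
      have hY' := smul_floquetSymbol (q := q) Y lam j₀ (hw' j₀)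
      rw [partialSymbol_erase_update, Function.update_self] at hV' hY'
      rw [← hV', Matrix.det_smul] at h
      rw [← hY', Matrix.det_smul,
        hzero _ hw' ((mul_eq_zero.1 h).resolve_left (pow_ne_zero _ hx)), mul_zero])
  obtain ⟨p, hp⟩ := exists_polynomial_det_floquetSymbol (q := q) V lam w g
  obtain ⟨p', hp'⟩ := exists_polynomial_det_floquetSymbol (q := q) Y lam w g
  have heq : ∀ᶠ t : ℕ in atTop, p.eval (t : ℂ) = p'.eval (t : ℂ) := by
    filter_upwards [hne, hquad] with t ht h
    have h := h (w j₀ + t * g j₀)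
    rw [← smul_floquetSymbol V lam (w := fun j => w j + t * g j) j₀ (ht j₀),
      ← smul_floquetSymbol Y lam (w := fun j => w j + t * g j) j₀ (ht j₀),
      Matrix.det_smul, Matrix.det_smul] at h
    rw [hp _ ht, hp' _ ht, mul_left_cancel₀ (pow_ne_zero _ (ht j₀)) h]
  have hpp : p = p' := by
    refine Polynomial.eq_of_infinite_eval_eq p p' ?_
    have hinf := Nat.frequently_atTop_iff_infinite.1 heq.frequently
    refine (hinf.image (Nat.cast_injective (R := ℂ)).injOn).mono ?_
    rintro _ ⟨t, ht, rfl⟩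
    exact ht
  have h0 := hp 0 (by simpa using hw)
  have h0' := hp' 0 (by simpa using hw)
  simp only [zero_mul, add_zero] at h0 h0'
  rw [← hpp, h0] at h0'
  exact mul_left_cancel₀ (pow_ne_zero _ (Finset.prod_ne_zero_iff.2 fun j _ => hw j)) h0'

end Symbol

/-- Let `d ≥ 3` and let `V`, `Y` be real `Γ`-periodic potentials
on `ℤ^d`.  If `F_{λ₀}(V) = F_{λ₀}(Y)` for some `λ₀ ∈ ℂ`, then
`𝒫_V(z, λ₀) = 𝒫_Y(z, λ₀)` for all `z ∈ (ℂ∖{0})^d`. -/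
theorem statement10 (d : ℕ) (hd : 3 ≤ d) (q : Fin d → ℕ+)
    (hq : ∀ i j, i ≠ j → Nat.Coprime (q i) (q j))
    (V Y : (Fin d → ℤ) → ℝ) (hV : IsPeriodicR q V) (hY : IsPeriodicR q Y)
    (lam0 : ℂ)
    (hiso : FermiVariety q (fun n => ((V n : ℝ) : ℂ)) lam0
      = FermiVariety q (fun n => ((Y n : ℝ) : ℂ)) lam0) :
    ∀ z : Fin d → ℂ, (∀ j, z j ≠ 0) →
      scriptP q (fun n => ((V n : ℝ) : ℂ)) z lam0
        = scriptP q (fun n => ((Y n : ℝ) : ℂ)) z lam0 := by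
  intro z hz
  choose w hw using fun j => IsAlgClosed.exists_pow_nat_eq (z j) (q j).pos
  have hw0 : ∀ j, w j ≠ 0 := fun j h => hz j (by rw [← hw j, h, zero_pow (q j).ne_zero])
  have hzw : z = fun j => w j ^ (q j : ℕ) := funext fun j => (hw j).symm
  have hj : (⟨1, by omega⟩ : Fin d) ≠ ⟨0, by omega⟩ := by simp
  rw [hzw, scriptP_pow _ _ hw0, scriptP_pow _ _ hw0, Matrix.det_neg, Matrix.det_neg,
    det_floquetSymbol_eq hq hj (fun n j => congrArg Complex.ofReal (hV n j))
      (fun n j => congrArg Complex.ofReal (hY n j))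
      hiso hw0]

end
end

section
/- Let d≥3 and let V and Y be real Γ-periodic potentials on ℤ^d that are Fermi isospectral. If Y is (d_1,d_2,…,d_r)-separable, then V is (d_1,d_2,…,d_r)-separable. -/
noncomputable section

/-- The offset of the `i`-th block in a partition `d = D 0 + ⋯ + D (r-1)`. -/
def blockOffset {r : ℕ} (D : Fin r → ℕ) (i : Fin r) : ℕ :=
  ∑ i' ∈ Finset.univ.filter (fun i' : Fin r => i' < i), D i'

lemma blockOffset_add_lt {r : ℕ} (D : Fin r → ℕ) (i : Fin r) (t : Fin (D i)) :
    blockOffset D i + (t : ℕ) < ∑ i', D i' := by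
  have hnotmem : i ∉ Finset.univ.filter (fun i' : Fin r => i' < i) := by simp
  have h1 : blockOffset D i + D i = ∑ i' ∈ insert i (Finset.univ.filter (fun i' : Fin r => i' < i)), D i' := by
    rw [Finset.sum_insert hnotmem, blockOffset]; ring
  have h2 : ∑ i' ∈ insert i (Finset.univ.filter (fun i' : Fin r => i' < i)), D i' ≤ ∑ i', D i' :=
    Finset.sum_le_sum_of_subset (Finset.subset_univ _)
  have ht := t.isLt
  omega

/-- `(d₁, …, d_r)`-separability of a function on `ℤ^d`, where `d = Σ dᵢ`. -/
def IsSeparablePotential {d r : ℕ} (D : Fin r → ℕ) (hsum : ∑ i, D i = d)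
    (V : (Fin d → ℤ) → ℝ) : Prop :=
  ∃ Vi : ∀ i : Fin r, (Fin (D i) → ℤ) → ℝ,
    ∀ n : Fin d → ℤ,
      V n = ∑ i, Vi i (fun t => n ⟨blockOffset D i + (t : ℕ), hsum ▸ blockOffset_add_lt D i t⟩)


section FermiIsospectral

open Filter Topology

theorem exists_root_branch {F : ℂ × ℂ → ℂ} {t₀ c : ℂ} (hF : ContDiffAt ℂ 1 F (0, t₀))
    (h0 : F (0, t₀) = 0) (hc : HasDerivAt (fun t => F (0, t)) c t₀) (hc0 : c ≠ 0) :
    ∃ φ : ℂ → ℂ, Tendsto φ (𝓝 0) (𝓝 t₀) ∧ ∀ᶠ s in 𝓝 0, F (s, φ s) = 0 := by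
  have hs := hF.hasStrictFDerivAt (by norm_num)
  have hinr : HasDerivAt (fun t : ℂ => ((0 : ℂ), t)) ((0 : ℂ), (1 : ℂ)) t₀ :=
    (hasDerivAt_const t₀ (0 : ℂ)).prodMk (hasDerivAt_id t₀)
  have hcomp := hs.hasFDerivAt.comp_hasDerivAt t₀ hinr
  have hval : fderiv ℂ F (0, t₀) (0, 1) = c := hcomp.unique hc
  have hinv : (fderiv ℂ F (0, t₀) ∘L .inr ℂ ℂ ℂ).IsInvertible := by
    refine ⟨ContinuousLinearEquiv.unitsEquivAut ℂ (Units.mk0 c hc0), ?_⟩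
    ext
    simp [hval]
  refine ⟨hs.implicitFunctionOfProdDomain hinv, hs.tendsto_implicitFunctionOfProdDomain hinv, ?_⟩
  filter_upwards [hs.eventually_apply_implicitFunctionOfProdDomain hinv] with s hs'
  rw [hs', h0]

theorem exists_tendsto_of_det_eq_zero {ι : Type*} [Fintype ι] [DecidableEq ι] (o : ι)
    (B : Matrix ι ι ℂ) (η : ℂ → ι → ℂ) (h : ι → ℂ) (hh : ∀ i, i ≠ o → h i ≠ 0)
    (hη : ∀ i, Tendsto (fun s => η s i) (𝓝[≠] 0) (𝓝 (h i)))
    (hdet : ∀ᶠ s in 𝓝[≠] (0 : ℂ), (Matrix.diagonal (η s) + s • B).det = 0) :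
    ∃ r : ℂ → ℂ, Tendsto r (𝓝[≠] 0) (𝓝 (∑ i ∈ Finset.univ.erase o, B o i * B i o / h i)) ∧
      ∀ᶠ s in 𝓝[≠] (0 : ℂ), η s o + s * B o o = s ^ 2 * r s := by
  set M : ℂ → Matrix ι ι ℂ := fun s => Matrix.diagonal (η s) + s • B with hM
  set K : ℂ → Matrix ι ι ℂ := fun s => (M s).updateRow o (Pi.single o 1) with hK
  set K₀ : Matrix ι ι ℂ := Matrix.diagonal (Function.update h o 1) with hK₀
  have hMt : Tendsto M (𝓝[≠] 0) (𝓝 (Matrix.diagonal h)) := by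
    have hs : Tendsto (fun s : ℂ => s • B) (𝓝[≠] 0) (𝓝 ((0 : ℂ) • B)) :=
      ((continuous_id.smul continuous_const).tendsto 0).mono_left nhdsWithin_le_nhds
    have hd : Tendsto (fun s : ℂ => Matrix.diagonal (η s)) (𝓝[≠] 0) (𝓝 (Matrix.diagonal h)) :=
      ((continuous_id.matrix_diagonal).tendsto h).comp (tendsto_pi_nhds.2 hη)
    simpa using hd.add hs
  have hKt : Tendsto K (𝓝[≠] 0) (𝓝 K₀) := by
    have : (Matrix.diagonal h).updateRow o (Pi.single o 1) = K₀ := by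
      ext i j
      by_cases hi : i = o
      · subst hi
        by_cases hj : i = j
        · subst hj; simp [hK₀]
        · simp [hK₀, hj, Ne.symm hj]
      · simp [hK₀, Matrix.updateRow_apply, hi, Matrix.diagonal_apply]
    rw [← this]
    exact ((continuous_id.matrix_updateRow o continuous_const).tendsto _).comp hMt
  have hK₀det : K₀.det ≠ 0 := by
    rw [hK₀, Matrix.det_diagonal, Finset.prod_ne_zero_iff]
    intro i _
    by_cases hi : i = o
    · subst hi; simp
    · simpa [hi] using hh i hi
  set χ : ℂ → ι → ℂ := fun s => (K s)⁻¹.mulVec (Pi.single o 1) with hχ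
  have hdett : Tendsto (fun s => (K s).det) (𝓝[≠] 0) (𝓝 K₀.det) :=
    ((continuous_id.matrix_det).tendsto _).comp hKt
  have hKne : ∀ᶠ s in 𝓝[≠] (0 : ℂ), (K s).det ≠ 0 := hdett.eventually_ne hK₀det
  have hχt : Tendsto χ (𝓝[≠] 0) (𝓝 (Pi.single o 1)) := by
    have h1 : Tendsto (fun s => (K s)⁻¹) (𝓝[≠] 0) (𝓝 K₀⁻¹) := by
      simp only [Matrix.inv_def, Ring.inverse_eq_inv]
      exact (hdett.inv₀ hK₀det).smul (((continuous_id.matrix_adjugate).tendsto _).comp hKt)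
    have h2 : K₀⁻¹.mulVec (Pi.single o 1) = Pi.single o 1 := by
      have : K₀.mulVec (Pi.single o 1) = Pi.single o 1 := by
        ext i
        by_cases hi : i = o
        · subst hi; simp [hK₀]
        · simp [hK₀, hi]
      conv_lhs => rw [← this]
      rw [Matrix.mulVec_mulVec, Matrix.nonsing_inv_mul _ (isUnit_iff_ne_zero.2 hK₀det),
        Matrix.one_mulVec]
    rw [← h2]
    exact ((continuous_id.matrix_mulVec continuous_const).tendsto _).comp h1
  have hηne : ∀ᶠ s in 𝓝[≠] (0 : ℂ), ∀ i, i ≠ o → η s i ≠ 0 := by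
    refine eventually_all.2 fun i => ?_
    by_cases hi : i = o
    · simp [hi]
    · filter_upwards [(hη i).eventually_ne (hh i hi)] with s hs _ using hs
  refine ⟨fun s => ∑ i ∈ Finset.univ.erase o, B o i * B.mulVec (χ s) i / η s i, ?_, ?_⟩
  · refine tendsto_finsetSum _ fun i hi => ?_
    have hi' : i ≠ o := (Finset.mem_erase.1 hi).1
    have hB : Tendsto (fun s => B.mulVec (χ s) i) (𝓝[≠] 0) (𝓝 (B i o)) := by
      have := (((continuous_const (y := B)).matrix_mulVec continuous_id).tendsto
        (Pi.single o (1 : ℂ))).comp hχt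
      have := tendsto_pi_nhds.1 this i
      simpa using this
    exact (tendsto_const_nhds.mul hB).div (hη i) (hh i hi')
  · filter_upwards [hKne, hηne, hdet] with s hs hne hd
    obtain ⟨ψ, hψ0, hψ⟩ := Matrix.exists_mulVec_eq_zero_iff.2 hd
    have hKψ : (K s).mulVec ψ = ψ o • Pi.single o 1 := by
      ext i
      by_cases hi : i = o
      · subst hi
        simp [hK, Matrix.mulVec, Matrix.updateRow_self]
      · have : (M s).mulVec ψ i = 0 := congrFun hψ i
        simpa [hK, Matrix.mulVec, Matrix.updateRow_apply, hi] using this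
    have hψχ : ψ = ψ o • χ s := by
      rw [hχ, ← Matrix.mulVec_smul, ← hKψ, Matrix.mulVec_mulVec,
        Matrix.nonsing_inv_mul _ (isUnit_iff_ne_zero.2 hs), Matrix.one_mulVec]
    have hψo : ψ o ≠ 0 := by
      intro h0
      rw [h0, zero_smul] at hψχ
      exact hψ0 hψχ
    have hχo : χ s o = 1 := by
      have := congrFun hψχ o
      simp only [Pi.smul_apply, smul_eq_mul] at this
      exact mul_left_cancel₀ hψo (by rw [← this, mul_one])
    have hMχ : (M s).mulVec (χ s) = 0 := by
      have : ψ o • (M s).mulVec (χ s) = 0 := by rw [← Matrix.mulVec_smul, ← hψχ]; exact hψ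
      exact (smul_eq_zero.1 this).resolve_left hψo
    have hrow : ∀ i, η s i * χ s i + s * B.mulVec (χ s) i = 0 := by
      intro i
      have := congrFun hMχ i
      simpa [hM, Matrix.add_mulVec, Matrix.mulVec_diagonal, Matrix.smul_mulVec] using this
    have hχi : ∀ i, i ≠ o → χ s i = -s * (B.mulVec (χ s) i / η s i) := by
      intro i hi
      have := hne i hi
      field_simp
      linear_combination hrow i
    have h1 := hrow o
    rw [hχo, Matrix.mulVec, dotProduct, ← Finset.add_sum_erase _ _ (Finset.mem_univ o), hχo] at h1
    have h2 : ∑ i ∈ Finset.univ.erase o, B o i * χ s i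
        = -s * ∑ i ∈ Finset.univ.erase o, B o i * B.mulVec (χ s) i / η s i := by
      rw [Finset.mul_sum]
      refine Finset.sum_congr rfl fun i hi => ?_
      rw [hχi i (Finset.mem_erase.1 hi).1]
      ring
    rw [h2] at h1
    linear_combination h1

theorem sum_eq_sum_of_det_eq_zero {ι : Type*} [Fintype ι] [DecidableEq ι] (o : ι)
    (B C : Matrix ι ι ℂ) (η : ℂ → ι → ℂ) (h : ι → ℂ) (hh : ∀ i, i ≠ o → h i ≠ 0)
    (hη : ∀ i, Tendsto (fun s => η s i) (𝓝[≠] 0) (𝓝 (h i)))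
    (hB : ∀ᶠ s in 𝓝[≠] (0 : ℂ), (Matrix.diagonal (η s) + s • B).det = 0)
    (hC : ∀ᶠ s in 𝓝[≠] (0 : ℂ), (Matrix.diagonal (η s) + s • C).det = 0) :
    ∑ i ∈ Finset.univ.erase o, B o i * B i o / h i
      = ∑ i ∈ Finset.univ.erase o, C o i * C i o / h i := by
  obtain ⟨r, hr, hr'⟩ := exists_tendsto_of_det_eq_zero o B η h hh hη hB
  obtain ⟨t, ht, ht'⟩ := exists_tendsto_of_det_eq_zero o C η h hh hη hC
  have hs : ∀ᶠ s in 𝓝[≠] (0 : ℂ), s ≠ 0 := eventually_mem_nhdsWithin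
  have key : ∀ᶠ s in 𝓝[≠] (0 : ℂ), s * (r s - t s) = B o o - C o o := by
    filter_upwards [hr', ht', hs] with s h1 h2 h3
    apply mul_left_cancel₀ h3
    linear_combination h2 - h1
  have hlim : Tendsto (fun s => s * (r s - t s)) (𝓝[≠] (0 : ℂ)) (𝓝 0) := by
    have hid : Tendsto (fun s : ℂ => s) (𝓝[≠] (0 : ℂ)) (𝓝 0) := nhdsWithin_le_nhds
    simpa using hid.mul (hr.sub ht)
  have hoo : B o o - C o o = 0 :=
    tendsto_nhds_unique (tendsto_const_nhds.congr' (key.mono fun _ h => h.symm)) hlim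
  have heq : r =ᶠ[𝓝[≠] 0] t := by
    filter_upwards [key, hs] with s h1 h2
    rw [hoo] at h1
    exact sub_eq_zero.1 ((mul_eq_zero.1 h1).resolve_left h2)
  exact tendsto_nhds_unique hr (ht.congr' heq.symm)

/-- The symbol `-Σⱼ (uⱼ wⱼ + (uⱼ wⱼ)⁻¹)` of the Laplacian on a plane wave. -/
def laplaceSymbol {d : ℕ} (u w : Fin d → ℂ) : ℂ :=
  -∑ j, (u j * w j + (u j * w j)⁻¹)

theorem sum_eq_sum_of_singular_imp {ι : Type*} [Fintype ι] [DecidableEq ι] {d : ℕ} (o : ι)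
    (u : ι → Fin d → ℂ) (j₀ : Fin d) (B C : Matrix ι ι ℂ) (x : Fin d → ℂ)
    (hu : ∀ l j, u l j ≠ 0) (hx : ∀ j, x j ≠ 0) (ho : ∑ j, u o j * x j = 0)
    (hne : ∀ l, l ≠ o → ∑ j, u l j * x j ≠ 0)
    (himp : ∀ w : Fin d → ℂ, (∀ j, w j ≠ 0) →
      (Matrix.diagonal (fun l => laplaceSymbol (u l) w) + B).det = 0 →
      (Matrix.diagonal (fun l => laplaceSymbol (u l) w) + C).det = 0) :
    ∑ l ∈ Finset.univ.erase o, B o l * B l o / ∑ j, u l j * x j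
      = ∑ l ∈ Finset.univ.erase o, C o l * C l o / ∑ j, u l j * x j := by
  set X : ℂ → Fin d → ℂ := fun t => Function.update x j₀ t with hX
  have hX0 : X (x j₀) = x := Function.update_eq_self j₀ x
  set η : ℂ → ℂ → ι → ℂ := fun s t l => -∑ j, (u l j * X t j + s ^ 2 * (u l j * X t j)⁻¹) with hη
  have hcoord : ∀ j, ContDiff ℂ 1 fun t => X t j := by
    intro j
    by_cases hj : j = j₀
    · subst hj; simpa [hX] using contDiff_fun_id
    · simpa [hX, hj] using contDiff_const
  have hscale : ∀ (A : Matrix ι ι ℂ) (s t : ℂ), s ≠ 0 →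
      Matrix.diagonal (η s t) + s • A
        = s • (Matrix.diagonal (fun l => laplaceSymbol (u l) fun j => X t j / s) + A) := by
    intro A s t hs
    rw [smul_add, ← Matrix.diagonal_smul]
    congr 2
    ext l
    simp only [hη, laplaceSymbol, Pi.smul_apply, smul_eq_mul, mul_neg, Finset.mul_sum]
    congr 1
    refine Finset.sum_congr rfl fun j _ => ?_
    rw [mul_add, mul_div_assoc', inv_div]
    field_simp
  have hηC : ∀ l, ContDiffAt ℂ 1 (fun p : ℂ × ℂ => η p.1 p.2 l) (0, x j₀) := by
    intro l
    refine ContDiffAt.neg (ContDiffAt.sum fun j _ => ?_)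
    have h1 : ContDiffAt ℂ 1 (fun p : ℂ × ℂ => u l j * X p.2 j) (0, x j₀) :=
      contDiffAt_const.mul ((hcoord j).comp contDiff_snd).contDiffAt
    refine h1.add ((contDiffAt_fst.pow 2).mul (h1.inv ?_))
    simpa [hX0] using ⟨hu l j, hx j⟩
  set F : ℂ × ℂ → ℂ := fun p => (Matrix.diagonal (η p.1 p.2) + p.1 • B).det with hFdef
  have hF : ContDiffAt ℂ 1 F (0, x j₀) := by
    simp only [hFdef, Matrix.det_apply]
    refine ContDiffAt.sum fun σ _ => ?_
    refine ContDiffAt.const_smul _ (contDiffAt_prod fun i _ => ?_)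
    simp only [Matrix.add_apply, Matrix.smul_apply, smul_eq_mul]
    refine ContDiffAt.add ?_ (contDiffAt_fst.mul contDiffAt_const)
    by_cases hi : σ i = i
    · simpa [hi] using hηC i
    · simpa [hi] using contDiffAt_const
  have hη0 : ∀ t l, η 0 t l = -∑ j, u l j * X t j := by
    intro t l; simp [hη]
  have hder : ∀ l, HasDerivAt (fun t => η 0 t l) (-u l j₀) (x j₀) := by
    intro l
    have : (fun t => η 0 t l) = fun t => -(u l j₀ * t + ∑ j ∈ Finset.univ.erase j₀, u l j * x j) := by
      ext t
      rw [hη0, ← Finset.add_sum_erase _ _ (Finset.mem_univ j₀)]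
      congr 2
      · simp [hX]
      · exact Finset.sum_congr rfl fun j hj => by simp [hX, (Finset.mem_erase.1 hj).1]
    rw [this]
    simpa only [mul_one] using (((hasDerivAt_id' (x j₀)).const_mul (u l j₀)).add_const _).fun_neg
  have hF0 : (fun t => F (0, t)) = fun t => ∏ l, η 0 t l := by
    ext t; simp [hFdef, Matrix.det_diagonal]
  have hηx : ∀ l, η 0 (x j₀) l = -∑ j, u l j * x j := by
    intro l; rw [hη0, hX0]
  have hprod : HasDerivAt (fun t => F (0, t))
      ((∏ l ∈ Finset.univ.erase o, η 0 (x j₀) l) * -u o j₀) (x j₀) := by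
    rw [hF0]
    have := HasDerivAt.fun_finsetProd (u := Finset.univ) fun l _ => hder l
    rw [Finset.sum_eq_single o] at this
    · simpa using this
    · intro b _ hb
      rw [Finset.prod_eq_zero (i := o) (by simp [Ne.symm hb]) (by rw [hηx, ho, neg_zero]), zero_smul]
    · simp
  obtain ⟨φ, hφ, hφF⟩ := exists_root_branch hF
    (by
      rw [congrFun hF0 (x j₀)]
      exact Finset.prod_eq_zero (Finset.mem_univ o) (by rw [hηx, ho, neg_zero]))
    hprod
    (mul_ne_zero
      (Finset.prod_ne_zero_iff.2 fun l hl => by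
        rw [hηx]; exact neg_ne_zero.2 (hne l (Finset.mem_erase.1 hl).1))
      (neg_ne_zero.2 (hu o j₀)))
  have hsne : ∀ᶠ s in 𝓝[≠] (0 : ℂ), s ≠ 0 := eventually_mem_nhdsWithin
  have hB : ∀ᶠ s in 𝓝[≠] (0 : ℂ), (Matrix.diagonal (η s (φ s)) + s • B).det = 0 :=
    nhdsWithin_le_nhds hφF
  have hφne : ∀ᶠ s in 𝓝[≠] (0 : ℂ), φ s ≠ 0 := nhdsWithin_le_nhds (hφ.eventually_ne (hx j₀))
  have hC : ∀ᶠ s in 𝓝[≠] (0 : ℂ), (Matrix.diagonal (η s (φ s)) + s • C).det = 0 := by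
    filter_upwards [hB, hφne, hsne] with s h1 h2 h3
    rw [hscale _ _ _ h3, Matrix.det_smul] at h1 ⊢
    rw [himp _ ?_ ((mul_eq_zero.1 h1).resolve_left (pow_ne_zero _ h3)), mul_zero]
    intro j
    refine div_ne_zero ?_ h3
    by_cases hj : j = j₀
    · subst hj; simpa [hX] using h2
    · simpa [hX, hj] using hx j
  have hlim : ∀ l, Tendsto (fun s => η s (φ s) l) (𝓝[≠] 0) (𝓝 (-∑ j, u l j * x j)) := by
    intro l
    rw [← hηx]
    have h1 : Tendsto (fun s => (s, φ s)) (𝓝 0) (𝓝 ((0 : ℂ), x j₀)) := by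
      rw [nhds_prod_eq]; exact tendsto_id.prodMk hφ
    exact ((hηC l).continuousAt.tendsto.comp h1).mono_left nhdsWithin_le_nhds
  have := sum_eq_sum_of_det_eq_zero o B C (fun s => η s (φ s)) (fun l => -∑ j, u l j * x j)
    (fun l hl => neg_ne_zero.2 (hne l hl)) hlim hB hC
  simpa only [div_neg, Finset.sum_neg_distrib, neg_inj] using this

theorem eq_one_of_pow_eq_one_of_coprime {z : ℂ} {m n : ℕ} (hmn : Nat.Coprime m n)
    (hm : z ^ m = 1) (hn : z ^ n = 1) : z = 1 := by
  have h : orderOf z ∣ Nat.gcd m n :=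
    Nat.dvd_gcd (orderOf_dvd_of_pow_eq_one hm) (orderOf_dvd_of_pow_eq_one hn)
  rw [hmn, Nat.dvd_one] at h
  exact orderOf_eq_one_iff.1 h

/-- An affine map of `ℂ` sending three distinct points of the unit circle to the unit circle is
constant or a homothety centred at the origin. -/
theorem eq_zero_of_norm_affine_eq_one {α β a b c : ℂ} (hab : a ≠ b) (hac : a ≠ c) (hbc : b ≠ c)
    (ha : ‖a‖ = 1) (hb : ‖b‖ = 1) (hc : ‖c‖ = 1) (ha' : ‖α + β * a‖ = 1)
    (hb' : ‖α + β * b‖ = 1) (hc' : ‖α + β * c‖ = 1) (hβ : β ≠ 0) : α = 0 := by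
  have key : ∀ z : ℂ, ‖z‖ = 1 → ‖α + β * z‖ = 1 →
      α * star β + (α * star α + β * star β - 1) * z + star α * β * z ^ 2 = 0 := by
    intro z hz hz'
    have h1 : z * star z = 1 := by
      have := Complex.mul_conj' z
      rw [hz] at this; simpa using this
    have h2 : (α + β * z) * (star α + star β * star z) = 1 := by
      have := Complex.mul_conj' (α + β * z)
      rw [hz'] at this; simpa using this
    linear_combination z * h2 - (α * star β + β * star β * z) * h1
  have h1 := key a ha ha'
  have h2 := key b hb hb'
  have h3 := key c hc hc'
  have h12 : (α * star α + β * star β - 1) + star α * β * (a + b) = 0 := by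
    apply mul_left_cancel₀ (sub_ne_zero.2 hab)
    linear_combination h1 - h2
  have h13 : (α * star α + β * star β - 1) + star α * β * (a + c) = 0 := by
    apply mul_left_cancel₀ (sub_ne_zero.2 hac)
    linear_combination h1 - h3
  have h : star α * β = 0 := by
    apply mul_left_cancel₀ (sub_ne_zero.2 hbc)
    linear_combination h12 - h13
  simpa [hβ] using h

theorem exists_ne_ne_of_three_le {d : ℕ} (hd : 3 ≤ d) (a b : Fin d) : ∃ c, c ≠ a ∧ c ≠ b := by
  have : (({a, b} : Finset (Fin d))ᶜ).Nonempty := by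
    rw [← Finset.card_pos, Finset.card_compl, Fintype.card_fin]
    have := Finset.card_le_two (a := a) (b := b)
    omega
  obtain ⟨c, hc⟩ := this
  exact ⟨c, by simpa using hc⟩

/-- The vector orthogonal to `(1, 1, 1)` and `(uₐ, u_b, u_c)` supported on three coordinates. -/
def crossVec {d : ℕ} (u : Fin d → ℂ) (a b c : Fin d) : Fin d → ℂ :=
  Pi.single a (u b - u c) + Pi.single b (u c - u a) + Pi.single c (u a - u b)

theorem sum_mul_crossVec {d : ℕ} (u v : Fin d → ℂ) (a b c : Fin d) :
    ∑ j, v j * crossVec u a b c j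
      = v a * (u b - u c) + v b * (u c - u a) + v c * (u a - u b) := by
  simp [crossVec, mul_add, Finset.sum_add_distrib, Pi.single_apply]

section RootVectors

variable {d : ℕ} {q : Fin d → ℕ}

theorem eq_one_of_eq_of_ne (hq : ∀ i j, i ≠ j → Nat.Coprime (q i) (q j)) {u : Fin d → ℂ}
    (hu : ∀ j, u j ^ q j = 1) {i j : Fin d} (hij : i ≠ j) (h : u i = u j) : u i = 1 :=
  eq_one_of_pow_eq_one_of_coprime (hq i j hij) (hu i) (h ▸ hu j)

theorem exists_orthogonal_sum_ne_zero (hd : 3 ≤ d) (hq0 : ∀ j, q j ≠ 0)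
    (hq : ∀ i j, i ≠ j → Nat.Coprime (q i) (q j)) {u v : Fin d → ℂ}
    (hu : ∀ j, u j ^ q j = 1) (hv : ∀ j, v j ^ q j = 1) {a b : Fin d} (hab : a ≠ b)
    (ha : u a ≠ 1) (hb : u b ≠ 1) (hv1 : v ≠ 1) (huv : v ≠ u) :
    ∃ x : Fin d → ℂ, ∑ j, x j = 0 ∧ ∑ j, u j * x j = 0 ∧ ∑ j, v j * x j ≠ 0 := by
  by_contra! hcon
  have huab : u a ≠ u b := fun h => ha (eq_one_of_eq_of_ne hq hu hab h)
  have hsub : u a - u b ≠ 0 := sub_ne_zero.2 huab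
  set β := (v a - v b) / (u a - u b) with hβ
  set α := v a - β * u a with hα
  have haff : ∀ c, v c = α + β * u c := by
    intro c
    have h1 := hcon (crossVec u a b c)
      (by have := sum_mul_crossVec u 1 a b c; simp only [Pi.one_apply, one_mul] at this
          rw [this]; ring)
      (by rw [sum_mul_crossVec]; ring)
    rw [sum_mul_crossVec] at h1
    rw [hα, hβ]
    field_simp
    linear_combination h1
  have hu1 : ∀ j, ‖u j‖ = 1 := fun j => Complex.norm_eq_one_of_pow_eq_one (hu j) (hq0 j)
  have hv1' : ∀ j, ‖α + β * u j‖ = 1 := fun j => by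
    rw [← haff j]; exact Complex.norm_eq_one_of_pow_eq_one (hv j) (hq0 j)
  obtain ⟨c, hca, hcb⟩ := exists_ne_ne_of_three_le hd a b
  have huac : u a ≠ u c := fun h => ha (eq_one_of_eq_of_ne hq hu hca.symm h)
  have hubc : u b ≠ u c := fun h => hb (eq_one_of_eq_of_ne hq hu hcb.symm h)
  by_cases hβ0 : β = 0
  · have hva : v a = 1 := by
      refine eq_one_of_eq_of_ne hq hv hab ?_
      rw [haff a, haff b, hβ0, zero_mul, zero_mul]
    apply hv1
    ext j
    rw [Pi.one_apply, haff j, hβ0, zero_mul, ← hva, haff a, hβ0, zero_mul]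
  · have hα0 := eq_zero_of_norm_affine_eq_one huab huac hubc (hu1 a) (hu1 b) (hu1 c)
      (hv1' a) (hv1' b) (hv1' c) hβ0
    have hpow : ∀ j, β ^ q j = 1 := by
      intro j
      have := hv j
      rwa [haff j, hα0, zero_add, mul_pow, hu j, mul_one] at this
    have hβ1 := eq_one_of_pow_eq_one_of_coprime (hq a b hab) (hpow a) (hpow b)
    apply huv
    ext j
    rw [haff j, hα0, hβ1, zero_add, one_mul]

theorem exists_orthogonal_apply_ne_zero (hd : 3 ≤ d)
    (hq : ∀ i j, i ≠ j → Nat.Coprime (q i) (q j)) {u : Fin d → ℂ}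
    (hu : ∀ j, u j ^ q j = 1) {a b : Fin d} (hab : a ≠ b)
    (ha : u a ≠ 1) (hb : u b ≠ 1) (j : Fin d) :
    ∃ x : Fin d → ℂ, ∑ j, x j = 0 ∧ ∑ j, u j * x j = 0 ∧ x j ≠ 0 := by
  obtain ⟨b', c', hb', hc', hbc⟩ : ∃ b c, b ≠ j ∧ c ≠ j ∧ u b ≠ u c := by
    obtain ⟨c, hca, hcb⟩ := exists_ne_ne_of_three_le hd a b
    by_cases hja : a = j
    · exact ⟨b, c, fun h => hab (hja.trans h.symm), fun h => hca (h.trans hja.symm),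
        fun h => hb (eq_one_of_eq_of_ne hq hu hcb.symm h)⟩
    · by_cases hjb : b = j
      · exact ⟨a, c, hja, fun h => hcb (h.trans hjb.symm),
          fun h => ha (eq_one_of_eq_of_ne hq hu hca.symm h)⟩
      · exact ⟨a, b, hja, hjb, fun h => ha (eq_one_of_eq_of_ne hq hu hab h)⟩
  refine ⟨crossVec u j b' c', ?_, ?_, ?_⟩
  · have := sum_mul_crossVec u 1 j b' c'
    simp only [Pi.one_apply, one_mul] at this
    rw [this]; ring
  · rw [sum_mul_crossVec]; ring
  · simpa [crossVec, hb'.symm, hc'.symm] using sub_ne_zero.2 hbc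

theorem exists_generic_orthogonal {L : Type*} [Finite L] (hd : 3 ≤ d) (hq0 : ∀ j, q j ≠ 0)
    (hq : ∀ i j, i ≠ j → Nat.Coprime (q i) (q j)) {u : L → Fin d → ℂ}
    (hu : ∀ l j, u l j ^ q j = 1) (hinj : Function.Injective u) {o l₀ : L} (ho : u o = 1)
    {a b : Fin d} (hab : a ≠ b) (ha : u l₀ a ≠ 1) (hb : u l₀ b ≠ 1) :
    ∃ x : Fin d → ℂ, ∑ j, x j = 0 ∧ ∑ j, u l₀ j * x j = 0 ∧ (∀ j, x j ≠ 0) ∧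
      ∀ l, l ≠ o → l ≠ l₀ → ∑ j, u l j * x j ≠ 0 := by
  let φ : (Fin d → ℂ) → Module.Dual ℂ (Fin d → ℂ) := fun v =>
    ∑ j, v j • LinearMap.proj j
  have hφ : ∀ v x, φ v x = ∑ j, v j * x j := by
    intro v x; simp [φ]
  let p : Submodule ℂ (Fin d → ℂ) := LinearMap.ker (φ 1) ⊓ LinearMap.ker (φ (u l₀))
  have hp : ∀ x, x ∈ p ↔ ∑ j, x j = 0 ∧ ∑ j, u l₀ j * x j = 0 := by
    intro x; simp [p, hφ]
  let f : Fin d ⊕ {l : L // l ≠ o ∧ l ≠ l₀} → Module.Dual ℂ (Fin d → ℂ) :=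
    Sum.elim (fun j => LinearMap.proj j) fun l => φ (u l)
  obtain ⟨x, hx, hx'⟩ := Module.Dual.exists_forall_mem_ne_zero_of_forall_exists p f (by
    rintro (j | ⟨l, hl1, hl2⟩)
    · obtain ⟨x, h1, h2, h3⟩ := exists_orthogonal_apply_ne_zero hd hq (hu l₀) hab ha hb j
      exact ⟨x, (hp x).2 ⟨h1, h2⟩, h3⟩
    · obtain ⟨x, h1, h2, h3⟩ := exists_orthogonal_sum_ne_zero hd hq0 hq (hu l₀) (hu l) hab ha hb
        (fun h => hl1 (hinj (h.trans ho.symm))) (fun h => hl2 (hinj h))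
      exact ⟨x, (hp x).2 ⟨h1, h2⟩, by simpa [f, hφ] using h3⟩)
  refine ⟨x, ((hp x).1 hx).1, ((hp x).1 hx).2, fun j => hx' (Sum.inl j), fun l h1 h2 => ?_⟩
  have := hx' (Sum.inr ⟨l, h1, h2⟩)
  simpa [f, hφ] using this

theorem coeff_eq_zero_of_sum_div_eq_zero {L : Type*} [Fintype L] [DecidableEq L] (hd : 3 ≤ d)
    (hq0 : ∀ j, q j ≠ 0)
    (hq : ∀ i j, i ≠ j → Nat.Coprime (q i) (q j)) {u : L → Fin d → ℂ}
    (hu : ∀ l j, u l j ^ q j = 1) (hinj : Function.Injective u) {o l₀ : L} (ho : u o = 1)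
    {a b : Fin d} (hab : a ≠ b) (ha : u l₀ a ≠ 1) (hb : u l₀ b ≠ 1) (c : L → ℂ)
    (hc : ∀ x : Fin d → ℂ, (∀ j, x j ≠ 0) → ∑ j, x j = 0 →
      (∀ l, l ≠ o → ∑ j, u l j * x j ≠ 0) →
      ∑ l ∈ Finset.univ.erase o, c l / ∑ j, u l j * x j = 0) : c l₀ = 0 := by
  obtain ⟨x, hx0, hxl, hxj, hx⟩ := exists_generic_orthogonal hd hq0 hq hu hinj ho hab ha hb
  have hl₀ : l₀ ≠ o := by
    rintro rfl
    exact ha (congrFun ho a)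
  set y : Fin d → ℂ := Pi.single a 1 - Pi.single b 1 with hy
  have hy0 : ∑ j, y j = 0 := by simp [hy]
  set S : L → ℂ → ℂ := fun l ε => ∑ j, u l j * (x j + ε * y j) with hS
  have hyl : ∑ j, u l₀ j * y j ≠ 0 := by
    have : ∑ j, u l₀ j * y j = u l₀ a - u l₀ b := by
      simp [hy, mul_sub, Pi.single_apply]
    rw [this]
    exact sub_ne_zero.2 fun h => ha (eq_one_of_eq_of_ne hq (hu l₀) hab h)
  have hSl : ∀ ε, S l₀ ε = ε * ∑ j, u l₀ j * y j := by
    intro ε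
    rw [Finset.mul_sum, ← zero_add (∑ j, ε * _), ← hxl, ← Finset.sum_add_distrib]
    exact Finset.sum_congr rfl fun j _ => by ring
  have hScont : ∀ l, Tendsto (S l) (𝓝[≠] 0) (𝓝 (∑ j, u l j * x j)) := by
    intro l
    have : Continuous (S l) := by fun_prop
    have h := (this.tendsto 0).mono_left (nhdsWithin_le_nhds (s := {0}ᶜ))
    simpa [hS] using h
  have hid : Tendsto (fun s : ℂ => s) (𝓝[≠] (0 : ℂ)) (𝓝 0) := nhdsWithin_le_nhds
  have hne : ∀ᶠ ε in 𝓝[≠] (0 : ℂ), ε ≠ 0 := eventually_mem_nhdsWithin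
  have hev1 : ∀ᶠ ε in 𝓝[≠] (0 : ℂ), ∀ j, x j + ε * y j ≠ 0 := by
    refine eventually_all.2 fun j => ?_
    have : Tendsto (fun ε : ℂ => x j + ε * y j) (𝓝[≠] 0) (𝓝 (x j)) := by
      simpa using (tendsto_const_nhds (x := x j)).add (hid.mul_const (y j))
    exact this.eventually_ne (hxj j)
  have hev2 : ∀ᶠ ε in 𝓝[≠] (0 : ℂ), ∀ l, l ≠ o → S l ε ≠ 0 := by
    refine eventually_all.2 fun l => ?_
    by_cases h1 : l = o
    · simp [h1]
    · by_cases h2 : l = l₀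
      · subst h2
        filter_upwards [hne] with ε hε _
        rw [hSl]
        exact mul_ne_zero hε hyl
      · filter_upwards [(hScont l).eventually_ne (hx l h1 h2)] with ε hε _ using hε
  have hzero : ∀ᶠ ε in 𝓝[≠] (0 : ℂ), c l₀ / (∑ j, u l₀ j * y j)
      + ε * ∑ l ∈ (Finset.univ.erase o).erase l₀, c l / S l ε = 0 := by
    filter_upwards [hev1, hev2, hne] with ε h1 h2 h3
    have h := hc (fun j => x j + ε * y j) h1
      (by rw [Finset.sum_add_distrib, hx0, ← Finset.mul_sum, hy0]; simp) h2
    rw [← Finset.add_sum_erase _ _ (Finset.mem_erase.2 ⟨hl₀, Finset.mem_univ l₀⟩)] at h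
    have h' : c l₀ / S l₀ ε + ∑ l ∈ (Finset.univ.erase o).erase l₀, c l / S l ε = 0 := h
    rw [hSl] at h'
    have h4 : c l₀ / (∑ j, u l₀ j * y j) = ε * (c l₀ / (ε * ∑ j, u l₀ j * y j)) := by
      field_simp
    rw [h4, ← mul_add, h', mul_zero]
  have hlim : Tendsto (fun ε => c l₀ / (∑ j, u l₀ j * y j)
      + ε * ∑ l ∈ (Finset.univ.erase o).erase l₀, c l / S l ε) (𝓝[≠] 0)
      (𝓝 (c l₀ / (∑ j, u l₀ j * y j))) := by
    have h1 : Tendsto (fun ε => ∑ l ∈ (Finset.univ.erase o).erase l₀, c l / S l ε) (𝓝[≠] 0)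
        (𝓝 (∑ l ∈ (Finset.univ.erase o).erase l₀, c l / ∑ j, u l j * x j)) := by
      refine tendsto_finsetSum _ fun l hl => ?_
      simp only [Finset.mem_erase] at hl
      exact tendsto_const_nhds.div (hScont l) (hx l hl.2.1 hl.1)
    simpa using tendsto_const_nhds.add (hid.mul h1)
  have := tendsto_nhds_unique hlim (tendsto_const_nhds.congr' (hzero.mono fun _ h => h.symm))
  exact (div_eq_zero_iff.1 this).resolve_right hyl

end RootVectors

section Fourier

variable {d : ℕ} {q : Fin d → ℕ} [∀ j, NeZero (q j)]

/-- The character `n ↦ ∏ⱼ e^{2πi lⱼ nⱼ / qⱼ}` of the finite group `∏ⱼ ℤ/qⱼ`. -/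
def torusChar (l n : ∀ j, ZMod (q j)) : ℂ :=
  ∏ j, ZMod.stdAddChar (l j * n j)

/-- The values of the character `torusChar l` at the coordinate vectors. -/
def torusFreq (l : ∀ j, ZMod (q j)) (j : Fin d) : ℂ :=
  ZMod.stdAddChar (l j)

theorem torusFreq_pow (l : ∀ j, ZMod (q j)) (j : Fin d) : torusFreq l j ^ q j = 1 := by
  rw [torusFreq, ← AddChar.map_nsmul_eq_pow, nsmul_eq_mul, ZMod.natCast_self, zero_mul,
    AddChar.map_zero_eq_one]

theorem torusFreq_eq_one_iff (l : ∀ j, ZMod (q j)) (j : Fin d) :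
    torusFreq l j = 1 ↔ l j = 0 := by
  rw [torusFreq, ← AddChar.map_zero_eq_one (ZMod.stdAddChar (N := q j)),
    ZMod.injective_stdAddChar.eq_iff]

theorem torusFreq_ne_zero (l : ∀ j, ZMod (q j)) (j : Fin d) : torusFreq l j ≠ 0 := by
  intro h
  have := torusFreq_pow l j
  rw [h, zero_pow (NeZero.ne _)] at this
  exact zero_ne_one this

theorem torusFreq_injective : Function.Injective (torusFreq (q := q)) := by
  intro l m h
  ext1 j
  exact ZMod.injective_stdAddChar (congrFun h j)

theorem torusFreq_zero : torusFreq (0 : ∀ j, ZMod (q j)) = 1 := by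
  ext j; simp [torusFreq]

theorem torusChar_add_left (l m n : ∀ j, ZMod (q j)) :
    torusChar (l + m) n = torusChar l n * torusChar m n := by
  simp [torusChar, add_mul, AddChar.map_add_eq_mul, Finset.prod_mul_distrib]

theorem torusChar_comm (l n : ∀ j, ZMod (q j)) : torusChar l n = torusChar n l := by
  simp [torusChar, mul_comm]

theorem torusChar_add_right (l m n : ∀ j, ZMod (q j)) :
    torusChar l (m + n) = torusChar l m * torusChar l n := by
  rw [torusChar_comm, torusChar_add_left, torusChar_comm m, torusChar_comm n]

theorem torusChar_single (l : ∀ j, ZMod (q j)) (j : Fin d) :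
    torusChar l (Pi.single j 1) = torusFreq l j := by
  rw [torusChar, Finset.prod_eq_single j]
  · simp [torusFreq]
  · intro i _ hi; simp [hi]
  · simp

theorem torusChar_neg_single (l : ∀ j, ZMod (q j)) (j : Fin d) :
    torusChar l (-Pi.single j 1) = (torusFreq l j)⁻¹ := by
  have h := torusChar_add_right l (Pi.single j 1) (-Pi.single j 1)
  rw [add_neg_cancel, torusChar_single] at h
  have h0 : torusChar l 0 = 1 := by simp [torusChar]
  rw [h0] at h
  exact eq_inv_of_mul_eq_one_right h.symm

theorem star_torusChar (l n : ∀ j, ZMod (q j)) : star (torusChar l n) = torusChar (-l) n := by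
  simp only [torusChar, star_prod, Pi.neg_apply, neg_mul, AddChar.map_neg_eq_conj]
  rfl

theorem sum_torusChar (l : ∀ j, ZMod (q j)) :
    ∑ n, torusChar l n = if l = 0 then (Fintype.card (∀ j, ZMod (q j)) : ℂ) else 0 := by
  have h : ∑ n, torusChar l n = ∏ j, ∑ t : ZMod (q j), ZMod.stdAddChar (l j * t) := by
    rw [Finset.prod_univ_sum, Fintype.piFinset_univ]
    rfl
  rw [h]
  have h2 : ∀ j, ∑ t : ZMod (q j), ZMod.stdAddChar (l j * t)
      = ((if l j = 0 then Fintype.card (ZMod (q j)) else 0 : ℕ) : ℂ) := by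
    intro j
    simp_rw [mul_comm (l j)]
    exact AddChar.sum_mulShift (l j) (ZMod.isPrimitive_stdAddChar _)
  simp_rw [h2]
  split_ifs with hl
  · subst hl; simp [Fintype.card_pi]
  · obtain ⟨j, hj⟩ := Function.ne_iff.1 hl
    exact Finset.prod_eq_zero (Finset.mem_univ j) (by
      have hj' : l j ≠ 0 := hj
      rw [if_neg hj', Nat.cast_zero])

/-- The Fourier coefficients of a function on `∏ⱼ ℤ/qⱼ`. -/
def fourierCoeffTorus (V : (∀ j, ZMod (q j)) → ℂ) (l : ∀ j, ZMod (q j)) : ℂ :=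
  (Fintype.card (∀ j, ZMod (q j)) : ℂ)⁻¹ * ∑ n, torusChar (-l) n * V n

/-- The matrix whose columns are the characters of `∏ⱼ ℤ/qⱼ`. -/
def fourierMatrix (q : Fin d → ℕ) [∀ j, NeZero (q j)] :
    Matrix (∀ j, ZMod (q j)) (∀ j, ZMod (q j)) ℂ :=
  Matrix.of fun n l => torusChar l n

/-- The inverse of `fourierMatrix`. -/
def fourierMatrixInv (q : Fin d → ℕ) [∀ j, NeZero (q j)] :
    Matrix (∀ j, ZMod (q j)) (∀ j, ZMod (q j)) ℂ :=
  Matrix.of fun l n => (Fintype.card (∀ j, ZMod (q j)) : ℂ)⁻¹ * torusChar (-l) n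

theorem fourierMatrixInv_mul : fourierMatrixInv q * fourierMatrix q = 1 := by
  ext l m
  simp only [fourierMatrixInv, fourierMatrix, Matrix.mul_apply, Matrix.of_apply, mul_assoc,
    ← torusChar_add_left, ← Finset.mul_sum, sum_torusChar, Matrix.one_apply]
  by_cases h : l = m
  · simp [h, -Fintype.card_pi]
  · have : -l + m ≠ 0 := fun h' => h (neg_add_eq_zero.1 h')
    simp [h, this]

theorem fourierMatrix_mul_inv : fourierMatrix q * fourierMatrixInv q = 1 :=
  mul_eq_one_comm.1 fourierMatrixInv_mul

theorem fourier_inversion (V : (∀ j, ZMod (q j)) → ℂ) (n : ∀ j, ZMod (q j)) :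
    V n = ∑ l, fourierCoeffTorus V l * torusChar l n := by
  have h := congrFun (congrArg (fun A => A.mulVec V) (fourierMatrix_mul_inv (q := q))) n
  simp only [← Matrix.mulVec_mulVec, Matrix.one_mulVec] at h
  rw [← h]
  simp only [Matrix.mulVec, dotProduct, fourierMatrix, fourierMatrixInv, Matrix.of_apply,
    fourierCoeffTorus, Finset.mul_sum, Finset.sum_mul]
  exact Finset.sum_congr rfl fun l _ => Finset.sum_congr rfl fun m _ => by ring

/-- Multiplication by `V`, expressed in the basis of characters. -/
def potentialMatrix (V : (∀ j, ZMod (q j)) → ℂ) :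
    Matrix (∀ j, ZMod (q j)) (∀ j, ZMod (q j)) ℂ :=
  Matrix.of fun m l => fourierCoeffTorus V (m - l)

theorem fourierMatrix_mul_potentialMatrix (V : (∀ j, ZMod (q j)) → ℂ) :
    fourierMatrix q * potentialMatrix V = Matrix.diagonal V * fourierMatrix q := by
  ext n l
  rw [Matrix.diagonal_mul, Matrix.mul_apply]
  simp only [fourierMatrix, potentialMatrix, Matrix.of_apply]
  rw [fourier_inversion V n, Finset.sum_mul, ← Equiv.sum_comp (Equiv.addRight l)]
  refine Finset.sum_congr rfl fun m _ => ?_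
  simp only [Equiv.coe_addRight, add_sub_cancel_right, torusChar_add_left]
  ring

/-- The Floquet operator on `∏ⱼ ℤ/qⱼ` after gauging the boundary conditions into the
hopping terms. -/
def floquetOp (w : Fin d → ℂ) (V : (∀ j, ZMod (q j)) → ℂ) (lam : ℂ)
    (v : (∀ j, ZMod (q j)) → ℂ) (g : ∀ j, ZMod (q j)) : ℂ :=
  -(∑ j, (w j * v (g + Pi.single j 1) + (w j)⁻¹ * v (g - Pi.single j 1))) + V g * v g - lam * v g

/-- The Floquet operator in the basis of characters. -/
def floquetMatrix (w : Fin d → ℂ) (V : (∀ j, ZMod (q j)) → ℂ) (lam : ℂ) :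
    Matrix (∀ j, ZMod (q j)) (∀ j, ZMod (q j)) ℂ :=
  Matrix.diagonal (fun l => laplaceSymbol (torusFreq l) w) + (potentialMatrix V - lam • 1)

theorem floquetOp_fourierMatrix_mulVec (w : Fin d → ℂ) (V : (∀ j, ZMod (q j)) → ℂ) (lam : ℂ)
    (ψ : (∀ j, ZMod (q j)) → ℂ) :
    floquetOp w V lam ((fourierMatrix q).mulVec ψ)
      = (fourierMatrix q).mulVec ((floquetMatrix w V lam).mulVec ψ) := by
  have hP : (fourierMatrix q).mulVec ((potentialMatrix V).mulVec ψ)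
      = fun g => V g * (fourierMatrix q).mulVec ψ g := by
    rw [Matrix.mulVec_mulVec, fourierMatrix_mul_potentialMatrix, ← Matrix.mulVec_mulVec]
    ext g
    rw [Matrix.mulVec_diagonal]
  have hA : ∀ g, -(∑ j, (w j * (fourierMatrix q).mulVec ψ (g + Pi.single j 1)
        + (w j)⁻¹ * (fourierMatrix q).mulVec ψ (g - Pi.single j 1)))
      = (fourierMatrix q).mulVec
        ((Matrix.diagonal fun l => laplaceSymbol (torusFreq l) w).mulVec ψ) g := by
    intro g
    simp only [Matrix.mulVec, dotProduct, fourierMatrix, Matrix.of_apply, sub_eq_add_neg,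
      torusChar_add_right, torusChar_single, torusChar_neg_single, Matrix.diagonal_apply,
      ite_mul, zero_mul, Finset.sum_ite_eq, Finset.mem_univ, if_true, laplaceSymbol,
      Finset.mul_sum, Finset.sum_mul, ← Finset.sum_add_distrib, ← Finset.sum_neg_distrib]
    rw [Finset.sum_comm]
    refine Finset.sum_congr rfl fun l _ => Finset.sum_congr rfl fun j _ => ?_
    rw [mul_inv]
    ring
  ext g
  rw [floquetOp, hA, floquetMatrix, Matrix.add_mulVec, Matrix.sub_mulVec, Matrix.mulVec_add,
    Matrix.mulVec_sub, hP, Matrix.smul_mulVec, Matrix.one_mulVec, Matrix.mulVec_smul]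
  simp
  ring

theorem exists_floquetOp_eq_zero_iff (w : Fin d → ℂ) (V : (∀ j, ZMod (q j)) → ℂ) (lam : ℂ) :
    (∃ v, v ≠ 0 ∧ floquetOp w V lam v = 0) ↔ (floquetMatrix w V lam).det = 0 := by
  rw [← Matrix.exists_mulVec_eq_zero_iff]
  have hinj : ∀ ψ, (fourierMatrix q).mulVec ψ = 0 → ψ = 0 := by
    intro ψ h
    rw [← Matrix.one_mulVec ψ, ← fourierMatrixInv_mul, ← Matrix.mulVec_mulVec, h,
      Matrix.mulVec_zero]
  constructor
  · rintro ⟨v, hv, h⟩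
    have hv' : v = (fourierMatrix q).mulVec ((fourierMatrixInv q).mulVec v) := by
      rw [Matrix.mulVec_mulVec, fourierMatrix_mul_inv, Matrix.one_mulVec]
    refine ⟨(fourierMatrixInv q).mulVec v, fun h0 => hv ?_, hinj _ ?_⟩
    · rw [hv', h0, Matrix.mulVec_zero]
    · rw [← floquetOp_fourierMatrix_mulVec, ← hv', h]
  · rintro ⟨ψ, hψ, h⟩
    refine ⟨(fourierMatrix q).mulVec ψ, fun h0 => hψ (hinj ψ h0), ?_⟩
    rw [floquetOp_fourierMatrix_mulVec, h, Matrix.mulVec_zero]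

end Fourier

section Reduction

variable {d : ℕ}

theorem eq_of_periodic_of_cast_eq {α : Type*} {q : Fin d → ℕ} {f : (Fin d → ℤ) → α}
    (hf : ∀ n j, f (Function.update n j (n j + (q j : ℤ))) = f n) {n m : Fin d → ℤ}
    (h : ∀ j, (n j : ZMod (q j)) = m j) : f n = f m := by
  have step : ∀ (p : Fin d → ℤ) (j : Fin d) (a : ℤ), (a : ZMod (q j)) = p j →
      f (Function.update p j a) = f p := by
    intro p j a ha
    have hper : Function.Periodic (fun t => f (Function.update p j t)) (q j : ℤ) := by
      intro t
      have := hf (Function.update p j t) j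
      simpa using this
    obtain ⟨c, hc⟩ := (ZMod.intCast_eq_intCast_iff_dvd_sub (p j) a (q j)).1 ha.symm
    have := hper.int_mul c (p j)
    simp only [Int.cast_id, Function.update_eq_self] at this
    rw [← this]
    congr 2
    linear_combination hc
  have key : ∀ s : Finset (Fin d), f (s.piecewise m n) = f n := by
    intro s
    induction s using Finset.induction_on with
    | empty => simp
    | insert j s hj ih =>
      rw [Finset.piecewise_insert, step, ih]
      rw [Finset.piecewise_eq_of_notMem _ _ _ hj]
      exact (h j).symm
  have := key Finset.univ
  rw [Finset.piecewise_univ] at this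
  exact this.symm

/-- Reduction `ℤ^d → ∏ⱼ ℤ/qⱼ`. -/
def torusRed (q : Fin d → ℕ) (n : Fin d → ℤ) : ∀ j, ZMod (q j) :=
  fun j => n j

/-- The function on `∏ⱼ ℤ/qⱼ` induced by a function on `ℤ^d`. -/
def torusLift {α : Type*} (q : Fin d → ℕ) (f : (Fin d → ℤ) → α) (g : ∀ j, ZMod (q j)) : α :=
  f fun j => (g j).val

theorem torusLift_torusRed {α : Type*} {q : Fin d → ℕ} [∀ j, NeZero (q j)]
    {f : (Fin d → ℤ) → α}
    (hf : ∀ n j, f (Function.update n j (n j + (q j : ℤ))) = f n) (n : Fin d → ℤ) :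
    torusLift q f (torusRed q n) = f n := by
  refine eq_of_periodic_of_cast_eq hf fun j => ?_
  simp [torusRed]

theorem torusRed_surjective (q : Fin d → ℕ) [∀ j, NeZero (q j)] :
    Function.Surjective (torusRed q) := by
  intro g
  exact ⟨fun j => (g j).val, by ext j; simp [torusRed]⟩

theorem torusRed_update_add (q : Fin d → ℕ) (n : Fin d → ℤ) (j : Fin d) (a : ℤ) :
    torusRed q (Function.update n j (n j + a)) = torusRed q n + Pi.single j (a : ZMod (q j)) := by
  ext i
  by_cases hi : i = j
  · subst hi; simp [torusRed]
  · simp [torusRed, hi]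

theorem prod_zpow_update (w : Fin d → ℂ) (hw : ∀ j, w j ≠ 0) (n : Fin d → ℤ) (j : Fin d) (a : ℤ) :
    ∏ i, w i ^ (Function.update n j (n j + a) i) = (∏ i, w i ^ n i) * w j ^ a := by
  have : ∀ i, w i ^ (Function.update n j (n j + a) i)
      = w i ^ n i * if i = j then w j ^ a else 1 := by
    intro i
    by_cases hi : i = j
    · subst hi; simp [zpow_add₀ (hw i)]
    · simp [hi]
  simp_rw [this]
  rw [Finset.prod_mul_distrib, Finset.prod_ite_eq' Finset.univ j, if_pos (Finset.mem_univ j)]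

theorem schroedinger_gauge (q : Fin d → ℕ) [∀ j, NeZero (q j)] {V : (Fin d → ℤ) → ℂ}
    (hV : ∀ n j, V (Function.update n j (n j + (q j : ℤ))) = V n) {w : Fin d → ℂ}
    (hw : ∀ j, w j ≠ 0) (lam : ℂ) (v : (∀ j, ZMod (q j)) → ℂ) {u : (Fin d → ℤ) → ℂ}
    (hu : ∀ n, u n = (∏ j, w j ^ n j) * v (torusRed q n)) (n : Fin d → ℤ) :
    -(discLap u n) + V n * u n - lam * u n
      = (∏ j, w j ^ n j) * floquetOp w (torusLift q V) lam v (torusRed q n) := by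
  have h1 : discLap u n = (∏ j, w j ^ n j) *
      ∑ j, (w j * v (torusRed q n + Pi.single j 1) + (w j)⁻¹ * v (torusRed q n - Pi.single j 1)) := by
    rw [discLap, Finset.mul_sum]
    refine Finset.sum_congr rfl fun j _ => ?_
    rw [hu, hu, sub_eq_add_neg (n j), prod_zpow_update w hw, prod_zpow_update w hw,
      torusRed_update_add, torusRed_update_add, Int.cast_one, Int.cast_neg, Int.cast_one,
      Pi.single_neg, ← sub_eq_add_neg, zpow_one, zpow_neg_one]
    ring
  rw [h1, floquetOp, torusLift_torusRed hV, hu]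
  ring

theorem mem_fermiVariety_iff (q : Fin d → ℕ+) {V : (Fin d → ℤ) → ℂ} (hV : IsPeriodic q V)
    {k w : Fin d → ℂ} (hw : ∀ j, w j ≠ 0)
    (hk : ∀ j, Complex.exp (2 * (Real.pi : ℂ) * Complex.I * k j) = w j ^ (q j : ℕ)) (lam : ℂ) :
    k ∈ FermiVariety q V lam ↔
      (floquetMatrix w (torusLift (fun j => (q j : ℕ)) V) lam).det = 0 := by
  have hE : ∀ n : Fin d → ℤ, ∏ j, w j ^ n j ≠ 0 := fun n =>
    Finset.prod_ne_zero_iff.2 fun j _ => zpow_ne_zero _ (hw j)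
  rw [← exists_floquetOp_eq_zero_iff]
  constructor
  · rintro ⟨u, hu0, hu, hbc⟩
    set f : (Fin d → ℤ) → ℂ := fun n => (∏ j, w j ^ n j)⁻¹ * u n with hf
    have hfper : ∀ n j, f (Function.update n j (n j + ((q j : ℕ) : ℤ))) = f n := by
      intro n j
      have hz := hw j
      have he := hE n
      simp only [hf, prod_zpow_update w hw, hbc, hk, zpow_natCast]
      field_simp
    have hu' : ∀ n, u n = (∏ j, w j ^ n j)
        * torusLift (fun j => (q j : ℕ)) f (torusRed (fun j => (q j : ℕ)) n) := by
      intro n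
      rw [torusLift_torusRed hfper, hf]
      exact (mul_inv_cancel_left₀ (hE n) _).symm
    refine ⟨torusLift (fun j => (q j : ℕ)) f, ?_, ?_⟩
    · intro h0
      apply hu0
      ext n
      rw [hu', h0]
      simp
    · ext g
      obtain ⟨n, rfl⟩ := torusRed_surjective (fun j => (q j : ℕ)) g
      have := schroedinger_gauge (fun j => (q j : ℕ)) hV hw lam _ hu' n
      rw [hu n, sub_self] at this
      exact (mul_eq_zero.1 this.symm).resolve_left (hE n)
  · rintro ⟨v, hv0, hv⟩
    refine ⟨fun n => (∏ j, w j ^ n j) * v (torusRed (fun j => (q j : ℕ)) n), ?_, ?_, ?_⟩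
    · intro h0
      apply hv0
      ext g
      obtain ⟨n, rfl⟩ := torusRed_surjective (fun j => (q j : ℕ)) g
      exact (mul_eq_zero.1 (congrFun h0 n)).resolve_left (hE n)
    · intro n
      rw [← sub_eq_zero, schroedinger_gauge (fun j => (q j : ℕ)) hV hw lam v (fun _ => rfl) n, hv]
      simp
    · intro n j
      simp only [prod_zpow_update w hw, hk, torusRed_update_add, zpow_natCast, Int.cast_natCast,
        ZMod.natCast_self, Pi.single_zero, add_zero]
      ring

theorem exists_quasimomentum (q : Fin d → ℕ+) {w : Fin d → ℂ} (hw : ∀ j, w j ≠ 0) :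
    ∃ k : Fin d → ℂ, ∀ j,
      Complex.exp (2 * (Real.pi : ℂ) * Complex.I * k j) = w j ^ (q j : ℕ) := by
  refine ⟨fun j => (q j : ℕ) * Complex.log (w j) / (2 * (Real.pi : ℂ) * Complex.I), fun j => ?_⟩
  rw [mul_div_cancel₀ _ Complex.two_pi_I_ne_zero, Complex.exp_nat_mul, Complex.exp_log (hw j)]

end Reduction

section Separable

variable {d r : ℕ}

theorem blockOffset_eq_sum_castLE (D : Fin r → ℕ) (i : Fin r) :
    blockOffset D i = ∑ k : Fin i, D (Fin.castLE i.2.le k) := by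
  rw [blockOffset]
  symm
  refine Finset.sum_nbij (Fin.castLE i.2.le) ?_ ?_ ?_ fun _ _ => rfl
  · intro k _
    exact Finset.mem_filter.2 ⟨Finset.mem_univ _, k.2⟩
  · exact (Fin.castLE_injective i.2.le).injOn
  · intro k hk
    have hk' : k < i := by simpa using hk
    exact ⟨⟨k, hk'⟩, by simp, rfl⟩

/-- Coordinates of `ℤ^d`, labelled by a block and a position in that block. -/
def blockEquiv (D : Fin r → ℕ) (hsum : ∑ i, D i = d) : (Σ i, Fin (D i)) ≃ Fin d :=
  finSigmaFinEquiv.trans (finCongr hsum)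

theorem blockEquiv_apply (D : Fin r → ℕ) (hsum : ∑ i, D i = d) (i : Fin r) (t : Fin (D i)) :
    blockEquiv D hsum ⟨i, t⟩ = ⟨blockOffset D i + t, hsum ▸ blockOffset_add_lt D i t⟩ := by
  ext
  simp [blockEquiv, finSigmaFinEquiv_apply, blockOffset_eq_sum_castLE]

/-- The block containing a given coordinate. -/
def blockOf (D : Fin r → ℕ) (hsum : ∑ i, D i = d) (a : Fin d) : Fin r :=
  ((blockEquiv D hsum).symm a).1

theorem isSeparablePotential_iff (D : Fin r → ℕ) (hsum : ∑ i, D i = d) (V : (Fin d → ℤ) → ℝ) :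
    IsSeparablePotential D hsum V ↔ ∃ Vi : ∀ i : Fin r, (Fin (D i) → ℤ) → ℝ,
      ∀ n, V n = ∑ i, Vi i fun t => n (blockEquiv D hsum ⟨i, t⟩) := by
  simp only [IsSeparablePotential, blockEquiv_apply]

theorem IsSeparablePotential.mixed_difference {D : Fin r → ℕ} {hsum : ∑ i, D i = d}
    {V : (Fin d → ℤ) → ℝ} (hV : IsSeparablePotential D hsum V) {a b : Fin d}
    (hab : blockOf D hsum a ≠ blockOf D hsum b) (n x y : Fin d → ℤ)
    (hx : ∀ j, j ≠ a → x j = 0) (hy : ∀ j, j ≠ b → y j = 0) :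
    V (n + x + y) - V (n + x) - V (n + y) + V n = 0 := by
  obtain ⟨Vi, hVi⟩ := (isSeparablePotential_iff D hsum V).1 hV
  simp only [hVi, ← Finset.sum_sub_distrib, ← Finset.sum_add_distrib]
  refine Finset.sum_eq_zero fun i _ => ?_
  have hblk : ∀ (t : Fin (D i)) (c : Fin d), blockOf D hsum c ≠ i →
      blockEquiv D hsum ⟨i, t⟩ ≠ c := by
    rintro t c hc rfl
    simp [blockOf] at hc
  by_cases hi : blockOf D hsum a = i
  · have : ∀ t, y (blockEquiv D hsum ⟨i, t⟩) = 0 := fun t =>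
      hy _ (hblk t b fun h => hab (hi.trans h.symm))
    simp [this]
  · have : ∀ t, x (blockEquiv D hsum ⟨i, t⟩) = 0 := fun t => hx _ (hblk t a hi)
    simp [this]

variable {q : Fin d → ℕ} [∀ j, NeZero (q j)]

theorem sum_torusChar_mul_shift (f : (∀ j, ZMod (q j)) → ℂ) (l : ∀ j, ZMod (q j)) (j : Fin d) :
    ∑ n, torusChar (-l) n * f (n + Pi.single j 1)
      = torusFreq l j * ∑ n, torusChar (-l) n * f n := by
  rw [← Equiv.sum_comp (Equiv.addRight (Pi.single j (1 : ZMod (q j))))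
    (fun n => torusChar (-l) n * f n), Finset.mul_sum]
  refine Finset.sum_congr rfl fun n _ => ?_
  have h : torusFreq l j * torusChar (-l) (Pi.single j 1) = 1 := by
    rw [← torusChar_single, ← torusChar_add_left, add_neg_cancel]
    simp [torusChar]
  simp only [Equiv.coe_addRight, torusChar_add_right]
  linear_combination (-(torusChar (-l) n * f (n + Pi.single j 1))) * h

theorem fourierCoeffTorus_eq_zero_of_mixed_difference {f : (∀ j, ZMod (q j)) → ℂ} {a b : Fin d}
    (hf : ∀ g, f (g + Pi.single a 1 + Pi.single b 1) - f (g + Pi.single a 1)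
      - f (g + Pi.single b 1) + f g = 0)
    {l : ∀ j, ZMod (q j)} (ha : l a ≠ 0) (hb : l b ≠ 0) : fourierCoeffTorus f l = 0 := by
  have h : ∑ n, torusChar (-l) n * (f (n + Pi.single a 1 + Pi.single b 1) - f (n + Pi.single a 1)
      - f (n + Pi.single b 1) + f n) = 0 :=
    Finset.sum_eq_zero fun n _ => by rw [hf, mul_zero]
  simp only [mul_add, mul_sub, Finset.sum_add_distrib, Finset.sum_sub_distrib] at h
  have hab := sum_torusChar_mul_shift (fun g => f (g + Pi.single b 1)) l a
  have hfa := sum_torusChar_mul_shift f l a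
  have hfb := sum_torusChar_mul_shift f l b
  beta_reduce at hab
  have h' : (torusFreq l a - 1) * (torusFreq l b - 1) * ∑ n, torusChar (-l) n * f n = 0 := by
    linear_combination h - hab - torusFreq l a * hfb + hfa + hfb
  have ha' : torusFreq l a - 1 ≠ 0 := sub_ne_zero.2 fun h => ha ((torusFreq_eq_one_iff l a).1 h)
  have hb' : torusFreq l b - 1 ≠ 0 := sub_ne_zero.2 fun h => hb ((torusFreq_eq_one_iff l b).1 h)
  rw [fourierCoeffTorus, (mul_eq_zero.1 h').resolve_left (mul_ne_zero ha' hb'), mul_zero]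

theorem IsSeparablePotential.fourierCoeffTorus_eq_zero {D : Fin r → ℕ} {hsum : ∑ i, D i = d}
    {V : (Fin d → ℤ) → ℝ} (hV : IsSeparablePotential D hsum V)
    (hper : ∀ n j, V (Function.update n j (n j + (q j : ℤ))) = V n) {a b : Fin d}
    (hab : blockOf D hsum a ≠ blockOf D hsum b) {l : ∀ j, ZMod (q j)} (ha : l a ≠ 0)
    (hb : l b ≠ 0) : fourierCoeffTorus (torusLift q fun n => (V n : ℂ)) l = 0 := by
  refine fourierCoeffTorus_eq_zero_of_mixed_difference (fun g => ?_) ha hb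
  obtain ⟨n, rfl⟩ := torusRed_surjective q g
  have hperC : ∀ n j, (fun n => (V n : ℂ)) (Function.update n j (n j + (q j : ℤ)))
      = (fun n => (V n : ℂ)) n := fun n j => congrArg _ (hper n j)
  have hred : ∀ (m : Fin d → ℤ) (j : Fin d),
      torusRed q m + Pi.single j 1 = torusRed q (m + Pi.single j 1) := by
    intro m j
    ext i
    by_cases hi : i = j
    · subst hi; simp [torusRed]
    · simp [torusRed, hi]
  have hlift := fun m => torusLift_torusRed (q := q) (f := fun n => (V n : ℂ)) hperC m
  simp only [hred, hlift]
  exact_mod_cast hV.mixed_difference hab n (Pi.single a 1) (Pi.single b 1)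
    (fun j hj => by simp [hj]) (fun j hj => by simp [hj])

theorem isSeparablePotential_of_fourierCoeffTorus_eq_zero (hd : 0 < d) {D : Fin r → ℕ}
    {hsum : ∑ i, D i = d} {V : (Fin d → ℤ) → ℝ}
    (hper : ∀ n j, V (Function.update n j (n j + (q j : ℤ))) = V n)
    (h : ∀ (a b : Fin d) (l : ∀ j, ZMod (q j)), blockOf D hsum a ≠ blockOf D hsum b →
      l a ≠ 0 → l b ≠ 0 → fourierCoeffTorus (torusLift q fun n => (V n : ℂ)) l = 0) :
    IsSeparablePotential D hsum V := by
  rw [isSeparablePotential_iff]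
  set c := fourierCoeffTorus (torusLift q fun n => (V n : ℂ)) with hc
  have hβ : ∀ l : ∀ j, ZMod (q j), ∃ i, c l ≠ 0 → ∀ a, blockOf D hsum a ≠ i → l a = 0 := by
    intro l
    by_cases hl : ∃ a, l a ≠ 0
    · obtain ⟨a, ha⟩ := hl
      refine ⟨blockOf D hsum a, fun hcl b hb => ?_⟩
      by_contra hlb
      exact hcl (h b a l hb hlb ha)
    · push Not at hl
      exact ⟨blockOf D hsum ⟨0, hd⟩, fun _ a _ => hl a⟩
  choose β hβ using hβ
  let extendZero (i : Fin r) (m : Fin (D i) → ℤ) : Fin d → ℤ :=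
    Function.extend (fun t => blockEquiv D hsum ⟨i, t⟩) m 0
  have hext : ∀ (n : Fin d → ℤ) (a : Fin d),
      extendZero (blockOf D hsum a) (fun t => n (blockEquiv D hsum ⟨_, t⟩)) a = n a := by
    intro n a
    have hinj : Function.Injective fun t => blockEquiv D hsum ⟨blockOf D hsum a, t⟩ :=
      (blockEquiv D hsum).injective.comp sigma_mk_injective
    have ha : a = blockEquiv D hsum ⟨blockOf D hsum a, ((blockEquiv D hsum).symm a).2⟩ :=
      ((blockEquiv D hsum).apply_symm_apply a).symm
    have := hinj.extend_apply (fun t => n (blockEquiv D hsum ⟨_, t⟩)) 0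
      ((blockEquiv D hsum).symm a).2
    simp only [← ha] at this
    exact this
  refine ⟨fun i m => (∑ l ∈ Finset.univ.filter (fun l => β l = i),
    c l * torusChar l (torusRed q (extendZero i m))).re, fun n => ?_⟩
  have hperC : ∀ n j, (fun n => (V n : ℂ)) (Function.update n j (n j + (q j : ℤ)))
      = (fun n => (V n : ℂ)) n := fun n j => congrArg _ (hper n j)
  have hinv := fourier_inversion (torusLift q fun n => (V n : ℂ)) (torusRed q n)
  rw [torusLift_torusRed hperC, ← Finset.sum_fiberwise Finset.univ β] at hinv
  rw [← Complex.re_sum, ← Complex.ofReal_re (V n), hinv]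
  congr 1
  refine Finset.sum_congr rfl fun i _ => Finset.sum_congr rfl fun l hl => ?_
  obtain rfl : β l = i := by simpa using hl
  by_cases hcl : c l = 0
  · rw [← hc, hcl, zero_mul, zero_mul]
  · congr 1
    refine Finset.prod_congr rfl fun a _ => ?_
    by_cases ha : blockOf D hsum a = β l
    · have := hext n a
      rw [ha] at this
      simp only [torusRed, this]
    · rw [hβ l hcl a ha, zero_mul, zero_mul]

end Separable

theorem fourierCoeffTorus_neg_of_real {d : ℕ} {q : Fin d → ℕ} [∀ j, NeZero (q j)]
    (V : (Fin d → ℤ) → ℝ) (l : ∀ j, ZMod (q j)) :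
    fourierCoeffTorus (torusLift q fun n => (V n : ℂ)) (-l)
      = star (fourierCoeffTorus (torusLift q fun n => (V n : ℂ)) l) := by
  have hV : ∀ n, star (torusLift q (fun n => (V n : ℂ)) n) = torusLift q (fun n => (V n : ℂ)) n :=
    fun n => Complex.conj_ofReal _
  simp [fourierCoeffTorus, star_mul', star_sum, star_torusChar, hV, -Fintype.card_pi]

theorem fourierCoeffTorus_mul_eq_of_fermiVariety_eq {d : ℕ} (hd : 3 ≤ d) (q : Fin d → ℕ+)
    (hq : ∀ i j, i ≠ j → Nat.Coprime (q i) (q j)) {V Y : (Fin d → ℤ) → ℂ}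
    (hV : IsPeriodic q V) (hY : IsPeriodic q Y) {lam : ℂ}
    (hiso : FermiVariety q V lam = FermiVariety q Y lam)
    {l : ∀ j, ZMod (q j : ℕ)} {a b : Fin d} (hab : a ≠ b) (ha : l a ≠ 0) (hb : l b ≠ 0) :
    fourierCoeffTorus (torusLift _ V) (-l) * fourierCoeffTorus (torusLift _ V) l
      = fourierCoeffTorus (torusLift _ Y) (-l) * fourierCoeffTorus (torusLift _ Y) l := by
  have himp : ∀ w : Fin d → ℂ, (∀ j, w j ≠ 0) →
      (floquetMatrix w (torusLift (fun j => (q j : ℕ)) V) lam).det = 0 →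
      (floquetMatrix w (torusLift (fun j => (q j : ℕ)) Y) lam).det = 0 := by
    intro w hw h
    obtain ⟨k, hk⟩ := exists_quasimomentum q hw
    rwa [← mem_fermiVariety_iff q hY hw hk, ← hiso, mem_fermiVariety_iff q hV hw hk]
  rw [← sub_eq_zero]
  refine coeff_eq_zero_of_sum_div_eq_zero (q := fun j => (q j : ℕ)) (u := torusFreq)
    (o := 0) (l₀ := l) hd (fun j => (q j).ne_zero) hq torusFreq_pow torusFreq_injective
    torusFreq_zero hab (fun h => ha ((torusFreq_eq_one_iff l a).1 h))
    (fun h => hb ((torusFreq_eq_one_iff l b).1 h))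
    (fun l => fourierCoeffTorus (torusLift _ V) (-l) * fourierCoeffTorus (torusLift _ V) l
      - fourierCoeffTorus (torusLift _ Y) (-l) * fourierCoeffTorus (torusLift _ Y) l) ?_
  intro x hx hx0 hxl
  have hentry : ∀ (W : (Fin d → ℤ) → ℂ), ∀ m ∈ Finset.univ.erase (0 : ∀ j, ZMod (q j : ℕ)),
      (potentialMatrix (torusLift (fun j => (q j : ℕ)) W) - lam • 1) 0 m
        * (potentialMatrix (torusLift (fun j => (q j : ℕ)) W) - lam • 1) m 0
      = fourierCoeffTorus (torusLift _ W) (-m) * fourierCoeffTorus (torusLift _ W) m := by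
    intro W m hm
    have hm0 : m ≠ 0 := (Finset.mem_erase.1 hm).1
    simp [potentialMatrix, hm0, hm0.symm]
  have h := sum_eq_sum_of_singular_imp (0 : ∀ j, ZMod (q j : ℕ)) torusFreq a
    (potentialMatrix (torusLift (fun j => (q j : ℕ)) V) - lam • 1)
    (potentialMatrix (torusLift (fun j => (q j : ℕ)) Y) - lam • 1) x
    torusFreq_ne_zero hx (by simpa [torusFreq_zero] using hx0) hxl himp
  simp only [sub_div, Finset.sum_sub_distrib]
  rw [sub_eq_zero]
  rw [Finset.sum_congr rfl fun m hm => by rw [← hentry V m hm], h]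
  exact Finset.sum_congr rfl fun m hm => by rw [hentry Y m hm]


end FermiIsospectral

/-- Let `d ≥ 3` and let `V`, `Y` be real `Γ`-periodic potentials
on `ℤ^d` that are Fermi isospectral.  If `Y` is `(d₁, …, d_r)`-separable, then so
is `V`. -/
theorem statement12 (d : ℕ) (hd : 3 ≤ d) (q : Fin d → ℕ+)
    (hq : ∀ i j, i ≠ j → Nat.Coprime (q i) (q j))
    (V Y : (Fin d → ℤ) → ℝ) (hV : IsPeriodicR q V) (hY : IsPeriodicR q Y)
    (lam0 : ℂ)
    (hiso : FermiVariety q (fun n => ((V n : ℝ) : ℂ)) lam0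
      = FermiVariety q (fun n => ((Y n : ℝ) : ℂ)) lam0)
    (r : ℕ) (D : Fin r → ℕ) (hD : ∀ i, 0 < D i) (hsum : ∑ i, D i = d)
    (hsep : IsSeparablePotential D hsum Y) :
    IsSeparablePotential D hsum V := by
  have hVC : IsPeriodic q fun n => ((V n : ℝ) : ℂ) := fun n j => congrArg _ (hV n j)
  have hYC : IsPeriodic q fun n => ((Y n : ℝ) : ℂ) := fun n j => congrArg _ (hY n j)
  refine isSeparablePotential_of_fourierCoeffTorus_eq_zero (q := fun j => (q j : ℕ)) (by omega) hV
    fun a b l hab ha hb => ?_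
  have h := fourierCoeffTorus_mul_eq_of_fermiVariety_eq hd q hq hVC hYC hiso
    (fun h => hab (congrArg _ h)) ha hb
  rw [hsep.fourierCoeffTorus_eq_zero (q := fun j => (q j : ℕ)) hY hab ha hb, mul_zero,
    fourierCoeffTorus_neg_of_real] at h
  simpa using h

end
end
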